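/- Let X be a separable Hilbert space with X = Y ⊕ Z as in the setup, and let φ ∈ C¹(X, ℝ) be an even functional such that ∇φ is weakly sequentially continuous, φ is τ-upper semi-continuous (i.e. for every c ∈ ℝ the set {u ∈ X : φ(u) ≥ c} is closed in the τ-topology), and φ satisfies the (PS)_c condition for every c > 0 (every sequence {u_n} with φ(u_n) → c and φ'(u_n) → 0 in X' has a convergent subsequence). Suppose that for every k ∈ ℕ there exist ρ_k > r_k > 0 such that (A₁) d_k := sup{φ(u) : u ∈ Y_k, ‖u‖ ≤ ρ_k} < ∞, (A₂) a_k := sup{φ(u) : u ∈ Y_k, ‖u‖ = ρ_k} ≤ 0, and (A₃) b_k := inf{φ(u) : u ∈ Z_k, ‖u‖ = r_k} → ∞ as k → ∞. Then φ has an unbounded sequence of critical values. -/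

import Mathlib

open Filter Topology Metric Set
open scoped RealInnerProductSpace

noncomputable section

/-- The setup of the fountain theorem: a separable Hilbert space `X = Y ⊕ Z`,
where `Y` is a closed subspace with orthonormal (topological) basis `e`,
`Z = Yᗮ` has orthonormal (topological) basis `f`, and `P`, `Q` are the
orthogonal projections onto `Y` and `Z` respectively. -/
structure FountainSetup (X : Type*) [NormedAddCommGroup X] [InnerProductSpace ℝ X]
    [CompleteSpace X] : Type _ where
  separable : TopologicalSpace.SeparableSpace X
  Y : Submodule ℝ X
  closedY : IsClosed (Y : Set X)
  e : ℕ → X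
  f : ℕ → X
  orth_e : Orthonormal ℝ e
  orth_f : Orthonormal ℝ f
  e_mem : ∀ j, e j ∈ Y
  f_mem : ∀ j, f j ∈ Yᗮ
  span_e : (Submodule.span ℝ (Set.range e)).topologicalClosure = Y
  span_f : (Submodule.span ℝ (Set.range f)).topologicalClosure = Yᗮ
  P : X →L[ℝ] X
  Q : X →L[ℝ] X
  P_mem : ∀ u, P u ∈ Y
  Q_mem : ∀ u, Q u ∈ Yᗮ
  P_add_Q : ∀ u, P u + Q u = u

namespace FountainSetup

variable {X : Type*} [NormedAddCommGroup X] [InnerProductSpace ℝ X] [CompleteSpace X]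
variable (S : FountainSetup X)

/-- `Y_k = Y ⊕ (⊕_{j=0}^{k} ℝ f_j)`. -/
def Yk (k : ℕ) : Submodule ℝ X := S.Y ⊔ Submodule.span ℝ (S.f '' {j | j ≤ k})

/-- `Z_k` = closure of `⊕_{j=k}^{∞} ℝ f_j`. -/
def Zk (k : ℕ) : Submodule ℝ X :=
  (Submodule.span ℝ (S.f '' {j | k ≤ j})).topologicalClosure

/-- The τ-norm `‖u‖_τ = max { Σ_j 2^{-(j+1)} |⟨Pu, e_j⟩| , ‖Qu‖ }`. -/
def tauNorm (u : X) : ℝ :=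
  max (∑' j : ℕ, (1 / 2 : ℝ) ^ (j + 1) * |⟪S.P u, S.e j⟫|) ‖S.Q u‖

/-- Convergence of a sequence in the τ-topology (which is induced by the norm `tauNorm`,
hence metrizable, so sequential convergence describes it completely). -/
def TauTendsto (u : ℕ → X) (v : X) : Prop :=
  Tendsto (fun n => S.tauNorm (u n - v)) atTop (𝓝 0)

end FountainSetup

/-- Weak convergence of a sequence in a Hilbert space. -/
def WeakConv {X : Type*} [NormedAddCommGroup X] [InnerProductSpace ℝ X]
    (u : ℕ → X) (v : X) : Prop :=
  ∀ w : X, Tendsto (fun n => ⟪u n, w⟫) atTop (𝓝 ⟪v, w⟫)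

/-- `∇φ` is weakly sequentially continuous: `φ'(u_n) v → φ'(u) v` for all `v`
whenever `u_n ⇀ u` weakly. -/
def WeaklySeqContDeriv {X : Type*} [NormedAddCommGroup X] [InnerProductSpace ℝ X]
    (φ' : X → X →L[ℝ] ℝ) : Prop :=
  ∀ (u : ℕ → X) (v : X), WeakConv u v →
    ∀ w : X, Tendsto (fun n => φ' (u n) w) atTop (𝓝 (φ' v w))

/-- Mod 2 coboundary of a cochain `c` on ordered simplices. -/
def cobdry {V : Type*} : List V → (List V → ZMod 2) → ZMod 2
  | [], _ => 0
  | a :: l, c => c l + cobdry l (fun x => c (a :: x))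

theorem cobdry_add {V : Type*} (l : List V) (c d : List V → ZMod 2) :
    cobdry l (fun x => c x + d x) = cobdry l c + cobdry l d := by
  induction l generalizing c d with
  | nil => simp [cobdry]
  | cons a l ih => simp only [cobdry, ih]; ring

theorem cobdry_map {V W : Type*} (f : V → W) (l : List V) (c : List W → ZMod 2) :
    cobdry l (fun x => c (x.map f)) = cobdry (l.map f) c := by
  induction l generalizing c with
  | nil => simp [cobdry]
  | cons a l ih =>
    simp only [cobdry, List.map_cons]
    rw [← ih (fun x => c (f a :: x))]

theorem cobdry_filter_mul {V : Type*} (p : V → Bool) (l : List V) (a b : List V → ZMod 2) :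
    cobdry l (fun x => a (x.filter p) * b (x.filter (fun v => !p v))) =
      cobdry (l.filter p) a * b (l.filter (fun v => !p v)) +
        a (l.filter p) * cobdry (l.filter (fun v => !p v)) b := by
  induction l generalizing a b with
  | nil => simp [cobdry]
  | cons x l ih =>
    by_cases hx : p x
    · have := ih (fun y => a (x :: y)) b
      simp only [cobdry, List.filter_cons, hx, if_true, Bool.not_true, Bool.false_eq_true,
        if_false] at this ⊢
      rw [this]; ring
    · have := ih a (fun y => b (x :: y))
      simp only [cobdry, List.filter_cons, hx, if_true, Bool.not_false, Bool.false_eq_true,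
        if_false] at this ⊢
      rw [this]; ring

theorem cobdry_eq_zero {V : Type*} (l : List V) (c : List V → ZMod 2)
    (h : ∀ x : List V, x.length + 1 = l.length → (∀ v ∈ x, v ∈ l) → c x = 0) :
    cobdry l c = 0 := by
  induction l generalizing c with
  | nil => rfl
  | cons a l ih =>
    simp only [cobdry]
    rw [h l rfl (fun v hv => List.mem_cons_of_mem _ hv), ih, add_zero]
    intro x hx hxl
    refine h _ (by simpa using hx) ?_
    intro v hv
    rcases List.mem_cons.1 hv with rfl | hv
    · simp
    · exact List.mem_cons_of_mem _ (hxl v hv)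

theorem cobdry_eq_nil {V : Type*} [DecidableEq V] (l : List V) :
    cobdry l (fun x => if x = [] then 1 else 0) = if l.length = 1 then 1 else 0 := by
  cases l with
  | nil => simp [cobdry]
  | cons a l =>
    simp only [cobdry]
    rw [cobdry_eq_zero]
    · simp
    · intros; simp

theorem cobdry_length_eq_one {V : Type*} (l : List V) :
    cobdry l (fun x => if x.length = 1 then 1 else 0) = 0 := by
  match l with
  | [] => rfl
  | [a] => simp [cobdry]
  | [a, b] => simp only [cobdry]; simp; rfl
  | a :: b :: c :: l =>
    apply cobdry_eq_zero
    intro x hx _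
    simp only [List.length_cons] at hx
    rw [if_neg (by omega)]

theorem cobdry_eq_singleton {V : Type*} [DecidableEq V] (v : V) (l : List V)
    (hl : ∀ x ∈ l, ∀ y ∈ l, x = y) :
    cobdry l (fun x => if x = [v] then 1 else 0) = 0 := by
  match l with
  | [] => rfl
  | [a] => simp [cobdry]
  | [a, b] =>
    obtain rfl : a = b := hl a (by simp) b (by simp)
    simp only [cobdry, List.cons.injEq, and_true, add_zero]
    split_ifs <;> rfl
  | a :: b :: c :: l =>
    apply cobdry_eq_zero
    intro x hx _
    simp only [List.length_cons] at hx
    rw [if_neg]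
    rintro rfl
    simp at hx

/-- Ky Fan's alternating cochain: it detects the lists of signed labels with indices `1, …, i`
that are pairwise distinct and alternate in sign, the top one having sign `ε`. -/
def altCochain : ℕ → Bool → List (ℕ × Bool) → ZMod 2
  | 0, _, l => if l = [] then 1 else 0
  | i + 1, ε, l =>
    (if l.filter (fun x => x.1 = i + 1) = [] then 1 else 0) *
        altCochain i ε (l.filter (fun x => !decide (x.1 = i + 1))) +
      (if l.filter (fun x => x.1 = i + 1) = [(i + 1, ε)] then 1 else 0) *
        altCochain i (!ε) (l.filter (fun x => !decide (x.1 = i + 1)))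

/-- No two labels in the list are opposite. -/
def NoOpposite (l : List (ℕ × Bool)) : Prop := ∀ x ∈ l, ∀ y ∈ l, x.1 = y.1 → x = y

theorem NoOpposite.filter {l : List (ℕ × Bool)} (h : NoOpposite l) (p : ℕ × Bool → Bool) :
    NoOpposite (l.filter p) := fun x hx y hy =>
  h x (List.mem_of_mem_filter hx) y (List.mem_of_mem_filter hy)

theorem cobdry_altCochain (i : ℕ) (ε : Bool) (l : List (ℕ × Bool)) (hl : NoOpposite l)
    (hi : ∀ x ∈ l, 1 ≤ x.1 ∧ x.1 ≤ i) :
    cobdry l (altCochain i ε) = altCochain i ε l + altCochain i (!ε) l := by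
  induction i generalizing ε l with
  | zero =>
    obtain rfl : l = [] := by
      rw [List.eq_nil_iff_forall_not_mem]
      intro x hx
      have := hi x hx
      omega
    simp [cobdry, altCochain]; rfl
  | succ i ih =>
    have e : altCochain (i + 1) ε = fun x =>
        (if x.filter (fun x => x.1 = i + 1) = [] then 1 else 0) *
          altCochain i ε (x.filter (fun x => !decide (x.1 = i + 1))) +
        (if x.filter (fun x => x.1 = i + 1) = [(i + 1, ε)] then 1 else 0) *
          altCochain i (!ε) (x.filter (fun x => !decide (x.1 = i + 1))) := by
      funext x; rfl
    have e1 := cobdry_filter_mul (fun x : ℕ × Bool => decide (x.1 = i + 1)) l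
      (fun y => if y = [] then 1 else 0) (altCochain i ε)
    have e2 := cobdry_filter_mul (fun x : ℕ × Bool => decide (x.1 = i + 1)) l
      (fun y => if y = [(i + 1, ε)] then 1 else 0) (altCochain i (!ε))
    beta_reduce at e1 e2
    rw [e, cobdry_add, e1, e2]
    have hmem : ∀ x ∈ l.filter (fun x => !decide (x.1 = i + 1)), 1 ≤ x.1 ∧ x.1 ≤ i := by
      intro x hx
      rw [List.mem_filter] at hx
      have := hi x hx.1
      have h2 : x.1 ≠ i + 1 := by simpa using hx.2
      omega
    have hmono : ∀ x ∈ l.filter (fun x => decide (x.1 = i + 1)),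
        ∀ y ∈ l.filter (fun x => decide (x.1 = i + 1)), x = y := by
      intro x hx y hy
      rw [List.mem_filter] at hx hy
      refine hl x hx.1 y hy.1 ?_
      have h1 : x.1 = i + 1 := by simpa using hx.2
      have h2 : y.1 = i + 1 := by simpa using hy.2
      rw [h1, h2]
    have hone : ∀ K : List (ℕ × Bool), (∀ x ∈ K, x.1 = i + 1) →
        (if K.length = 1 then (1 : ZMod 2) else 0) =
        (if K = [(i + 1, ε)] then 1 else 0) + (if K = [(i + 1, !ε)] then 1 else 0) := by
      intro K hK
      match K, hK with
      | [], _ => simp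
      | [(a, b)], hK =>
        obtain rfl : a = i + 1 := hK (a, b) (by simp)
        cases b <;> cases ε <;> simp
      | a :: b :: K, _ => simp
    rw [ih ε _ (hl.filter _) hmem, ih (!ε) _ (hl.filter _) hmem, cobdry_eq_nil,
      cobdry_eq_singleton _ _ hmono, hone _ (by
        intro x hx
        rw [List.mem_filter] at hx
        simpa using hx.2)]
    simp only [altCochain, Bool.not_not]
    have two : (2 : ZMod 2) = 0 := rfl
    linear_combination (if l.filter (fun x => decide (x.1 = i + 1)) = [(i + 1, ε)] then 1 else 0) *
      altCochain i ε (l.filter (fun x => !decide (x.1 = i + 1))) * two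

theorem altCochain_reverse (i : ℕ) (ε : Bool) (l : List (ℕ × Bool)) :
    altCochain i ε l.reverse = altCochain i ε l := by
  induction i generalizing ε l with
  | zero => simp [altCochain]
  | succ i ih =>
    simp only [altCochain, List.filter_reverse, ih, List.reverse_eq_nil_iff]
    have (K : List (ℕ × Bool)) (v : ℕ × Bool) : K.reverse = [v] ↔ K = [v] := by
      rw [List.reverse_eq_iff]; simp
    simp only [this]

/-- Action of the antipodal map on labels: the index `0` stands for an even function. -/
def antiLabel (x : ℕ × Bool) : ℕ × Bool := if x.1 = 0 then x else (x.1, !x.2)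

theorem altCochain_map_antiLabel (i : ℕ) (ε : Bool) (l : List (ℕ × Bool)) :
    altCochain i ε (l.map antiLabel) = altCochain i (!ε) l := by
  have key : ∀ x : ℕ × Bool, (antiLabel x).1 = x.1 := by
    intro x; unfold antiLabel; split_ifs <;> rfl
  induction i generalizing ε l with
  | zero => simp [altCochain]
  | succ i ih =>
    simp only [altCochain, List.filter_map, Function.comp_def, key, ih, List.map_eq_nil_iff]
    have inj : Function.Injective antiLabel := by
      rintro ⟨a, b⟩ ⟨c, d⟩ h
      have h1 := congrArg Prod.fst h
      rw [key, key] at h1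
      simp only at h1
      subst h1
      unfold antiLabel at h
      simp only at h
      split_ifs at h <;> simp_all
    have (K : List (ℕ × Bool)) : K.map antiLabel = [(i + 1, ε)] ↔ K = [(i + 1, !ε)] := by
      rw [← (List.map_injective_iff.2 inj).eq_iff (a := K)]
      simp [antiLabel]
    simp only [this]

theorem altCochain_eq_zero (i : ℕ) (ε : Bool) (l : List (ℕ × Bool)) (h : i < l.length) :
    altCochain i ε l = 0 := by
  induction i generalizing ε l with
  | zero => 
    have : l ≠ [] := by rintro rfl; simp at h
    simp [altCochain, this]
  | succ i ih =>
    have hs := List.length_eq_length_filter_add (l := l) (fun x => decide (x.1 = i + 1))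
    simp only [altCochain]
    by_cases h1 : (l.filter (fun x => decide (x.1 = i + 1))).length ≤ 1
    · rw [ih _ _ (by omega), ih _ _ (by omega)]; simp
    · rw [if_neg, if_neg]
      · simp
      · intro h2; rw [h2] at h1; simp at h1
      · intro h2; rw [h2] at h1; simp at h1

/-- The alternating cochain relative to the label `(0, true)`. -/
def fanCochain (m : ℕ) (ε : Bool) (l : List (ℕ × Bool)) : ZMod 2 :=
  (if (l.filter (fun x => decide (x = (0, true)))).length = 1 then 1 else 0) *
    altCochain m ε (l.filter (fun x => !decide (x = (0, true))))

theorem cobdry_fanCochain (m : ℕ) (ε : Bool) (l : List (ℕ × Bool)) (hl : NoOpposite l)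
    (hm : ∀ x ∈ l, x.1 ≤ m) :
    cobdry l (fanCochain m ε) = fanCochain m ε l + fanCochain m (!ε) l := by
  have e : fanCochain m ε = fun x =>
      (if (x.filter (fun x => decide (x = (0, true)))).length = 1 then 1 else 0) *
        altCochain m ε (x.filter (fun x => !decide (x = (0, true)))) := rfl
  have e1 := cobdry_filter_mul (fun x : ℕ × Bool => decide (x = (0, true))) l
    (fun y => if y.length = 1 then 1 else 0) (altCochain m ε)
  beta_reduce at e1
  rw [e, e1, cobdry_length_eq_one]
  simp only [fanCochain]
  by_cases h1 : (l.filter (fun x => decide (x = (0, true)))).length = 1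
  · obtain ⟨y, hy⟩ := List.length_eq_one_iff.1 h1
    have hyl : y ∈ l.filter (fun x => decide (x = (0, true))) := by rw [hy]; simp
    rw [List.mem_filter] at hyl
    obtain rfl : y = (0, true) := by simpa using hyl.2
    rw [cobdry_altCochain _ _ _ (hl.filter _)]
    · ring
    · intro x hx
      rw [List.mem_filter] at hx
      refine ⟨?_, hm x hx.1⟩
      by_contra h0
      have := hl x hx.1 _ hyl.1 (by simp; omega)
      simp [this] at hx
  · simp [h1]

theorem fanCochain_reverse (m : ℕ) (ε : Bool) (l : List (ℕ × Bool)) :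
    fanCochain m ε l.reverse = fanCochain m ε l := by
  simp only [fanCochain, List.filter_reverse, altCochain_reverse, List.length_reverse]

theorem fanCochain_map_antiLabel (m : ℕ) (ε : Bool) (l : List (ℕ × Bool)) :
    fanCochain m ε (l.map antiLabel) = fanCochain m (!ε) l := by
  have key : ∀ x : ℕ × Bool, antiLabel x = (0, true) ↔ x = (0, true) := by
    rintro ⟨a, b⟩
    unfold antiLabel
    by_cases h : a = 0 <;> simp [h]
  simp only [fanCochain, List.filter_map, Function.comp_def, key, altCochain_map_antiLabel,
    List.length_map]

theorem fanCochain_eq_zero_of_length (m : ℕ) (ε : Bool) (l : List (ℕ × Bool))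
    (h : m + 1 < l.length) : fanCochain m ε l = 0 := by
  have hs := List.length_eq_length_filter_add (l := l) (fun x => decide (x = (0, true)))
  simp only [fanCochain]
  split_ifs with h1
  · rw [altCochain_eq_zero _ _ _ (by omega)]; simp
  · simp

theorem fanCochain_eq_zero_of_forall (m : ℕ) (ε : Bool) (l : List (ℕ × Bool))
    (h : l.length ≠ 1) (hl : ∀ x ∈ l, x = (0, true)) : fanCochain m ε l = 0 := by
  have : l.filter (fun x => decide (x = (0, true))) = l := by
    rw [List.filter_eq_self]; simpa using hl
  simp [fanCochain, this, h]

theorem altCochain_nil (m : ℕ) (ε : Bool) : altCochain m ε [] = 1 := by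
  induction m generalizing ε with
  | zero => simp [altCochain]
  | succ m ih => simp [altCochain, ih]

theorem fanCochain_top (m : ℕ) (ε : Bool) : fanCochain m ε [(0, true)] = 1 := by
  simp [fanCochain, altCochain_nil]

theorem fanCochain_singleton_ne (m : ℕ) (ε : Bool) (x : ℕ × Bool) (hx : x ≠ (0, true)) :
    fanCochain m ε [x] = 0 := by
  simp [fanCochain, hx]

/-- Mod 2 evaluation of a cochain on the prism over an ordered simplex, in the `j`-th coordinate
direction, between the heights `s` and `s + 1`. -/
def prism (j : ℕ) (s : ℤ) : List (ℕ → ℤ) → (List (ℕ → ℤ) → ZMod 2) → ZMod 2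
  | [], _ => 0
  | a :: l, c =>
    c (Function.update a j s :: Function.update a j (s + 1) ::
        l.map (fun v => Function.update v j (s + 1))) +
      prism j s l (fun x => c (Function.update a j s :: x))

theorem prism_add (j : ℕ) (s : ℤ) (l : List (ℕ → ℤ)) (c d : List (ℕ → ℤ) → ZMod 2) :
    prism j s l (fun x => c x + d x) = prism j s l c + prism j s l d := by
  induction l generalizing c d with
  | nil => simp [prism]
  | cons a l ih => simp only [prism, ih]; ring

theorem prism_cobdry (j : ℕ) (s : ℤ) (l : List (ℕ → ℤ)) (c : List (ℕ → ℤ) → ZMod 2) :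
    prism j s l (fun x => cobdry x c) = cobdry l (fun x => prism j s x c) +
      (c (l.map (fun v => Function.update v j s)) +
        c (l.map (fun v => Function.update v j (s + 1)))) := by
  have two : (2 : ZMod 2) = 0 := rfl
  induction l generalizing c with
  | nil => simp only [prism, cobdry, List.map_nil]; linear_combination - c [] * two
  | cons a l ih =>
    simp only [prism, cobdry, List.map_cons, prism_add, cobdry_add]
    rw [ih (fun x => c (Function.update a j s :: x)),
      cobdry_map (fun v => Function.update v j (s + 1)) l
        (fun x => c (Function.update a j s :: Function.update a j (s + 1) :: x))]
    linear_combination (c (Function.update a j s :: l.map (fun v => Function.update v j (s + 1)))) * two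

theorem prism_congr (j : ℕ) (s : ℤ) (l : List (ℕ → ℤ)) (c d : List (ℕ → ℤ) → ZMod 2)
    (h : ∀ x : List (ℕ → ℤ), x.length = l.length + 1 →
      (∀ p ∈ x, ∃ q ∈ l, p = Function.update q j s ∨ p = Function.update q j (s + 1)) →
      c x = d x) : prism j s l c = prism j s l d := by
  induction l generalizing c d with
  | nil => rfl
  | cons a l ih =>
    simp only [prism]
    congr 1
    · apply h
      · simp
      · intro p hp
        simp only [List.mem_cons, List.mem_map] at hp
        rcases hp with rfl | rfl | ⟨q, hq, rfl⟩
        · exact ⟨a, by simp, Or.inl rfl⟩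
        · exact ⟨a, by simp, Or.inr rfl⟩
        · exact ⟨q, by simp [hq], Or.inr rfl⟩
    · apply ih
      intro x hx hxl
      apply h
      · simp [hx]
      · intro p hp
        rcases List.mem_cons.1 hp with rfl | hp
        · exact ⟨a, by simp, Or.inl rfl⟩
        · obtain ⟨q, hq, h⟩ := hxl p hp
          exact ⟨q, by simp [hq], h⟩

theorem prism_zero (j : ℕ) (s : ℤ) (l : List (ℕ → ℤ)) : prism j s l (fun _ => 0) = 0 := by
  induction l with
  | nil => rfl
  | cons a l ih => simp [prism, ih]

/-- The antipodal map on ordered simplices. -/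
def antiSimplex (l : List (ℕ → ℤ)) : List (ℕ → ℤ) := (l.map (fun v => -v)).reverse

theorem prism_append_singleton (j : ℕ) (s : ℤ) (l : List (ℕ → ℤ)) (a : ℕ → ℤ)
    (c : List (ℕ → ℤ) → ZMod 2) :
    prism j s (l ++ [a]) c =
      c (l.map (fun v => Function.update v j s) ++
        [Function.update a j s, Function.update a j (s + 1)]) +
      prism j s l (fun x => c (x ++ [Function.update a j (s + 1)])) := by
  induction l generalizing c with
  | nil => simp [prism]
  | cons b l ih =>
    simp only [List.cons_append, prism, ih, List.map_append, List.map_cons, List.map_nil]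
    ring

theorem prism_antiSimplex (j : ℕ) (s : ℤ) (l : List (ℕ → ℤ)) (c : List (ℕ → ℤ) → ZMod 2) :
    prism j s l (fun x => c (antiSimplex x)) = prism j (-s - 1) (antiSimplex l) c := by
  have up (v : ℕ → ℤ) (t : ℤ) : -Function.update v j t = Function.update (-v) j (-t) := by
    funext i
    by_cases h : i = j
    · subst h; simp
    · simp [h]
  induction l generalizing c with
  | nil => simp [prism, antiSimplex]
  | cons a l ih =>
    have e (b : ℕ → ℤ) (x : List (ℕ → ℤ)) : antiSimplex (b :: x) = antiSimplex x ++ [-b] := by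
      simp [antiSimplex]
    have h1 : -s - 1 + 1 = -s := by ring
    have h2 : -(s + 1) = -s - 1 := by ring
    simp only [prism, e, prism_append_singleton, List.append_assoc, List.cons_append,
      List.nil_append]
    rw [ih (fun x => c (x ++ [-Function.update a j s]))]
    simp only [up, h1, h2]
    congr 3
    simp [antiSimplex, List.map_reverse, Function.comp_def, up, h2]

/-- Mod 2 evaluation of a cochain on the triangulated cube `[-L, L]^j`. -/
def boxSum (L : ℤ) : ℕ → (List (ℕ → ℤ) → ZMod 2) → ZMod 2
  | 0, c => c [0]
  | j + 1, c => ∑ s ∈ Finset.Ico (-L) L, boxSum L j (fun l => prism j s l c)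

/-- A necessary condition for an ordered simplex to belong to the triangulated cube. -/
def IsBoxSimplex (L : ℤ) (j : ℕ) (l : List (ℕ → ℤ)) : Prop :=
  l.length = j + 1 ∧ (∀ v ∈ l, ∀ i, |v i| ≤ L ∧ (j ≤ i → v i = 0)) ∧
    ∀ v ∈ l, ∀ w ∈ l, ∀ i, |v i - w i| ≤ 1

theorem prism_congr_of_isBoxSimplex {L : ℤ} {j : ℕ} {s : ℤ} (hs : s ∈ Finset.Ico (-L) L)
    {l : List (ℕ → ℤ)} (hl : IsBoxSimplex L j l) {c d : List (ℕ → ℤ) → ZMod 2}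
    (h : ∀ l, IsBoxSimplex L (j + 1) l → c l = d l) : prism j s l c = prism j s l d := by
  rw [Finset.mem_Ico] at hs
  obtain ⟨h1, h2, h3⟩ := hl
  apply prism_congr
  intro x hx hxl
  apply h
  have key : ∀ p ∈ x, ∃ q ∈ l, ∃ t, (t = s ∨ t = s + 1) ∧ p = Function.update q j t := by
    intro p hp
    obtain ⟨q, hq, h | h⟩ := hxl p hp
    · exact ⟨q, hq, s, Or.inl rfl, h⟩
    · exact ⟨q, hq, s + 1, Or.inr rfl, h⟩
  refine ⟨by omega, ?_, ?_⟩
  · intro v hv i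
    obtain ⟨q, hq, t, ht, rfl⟩ := key v hv
    by_cases hi : i = j
    · subst hi
      simp only [Function.update_self]
      refine ⟨?_, by omega⟩
      rw [abs_le]; omega
    · rw [Function.update_of_ne hi]
      exact ⟨(h2 q hq i).1, fun h => (h2 q hq i).2 (by omega)⟩
  · intro v hv w hw i
    obtain ⟨q, hq, t, ht, rfl⟩ := key v hv
    obtain ⟨q', hq', t', ht', rfl⟩ := key w hw
    by_cases hi : i = j
    · subst hi
      simp only [Function.update_self]
      rw [abs_le]; omega
    · rw [Function.update_of_ne hi, Function.update_of_ne hi]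
      exact h3 q hq q' hq' i

theorem boxSum_congr {L : ℤ} (hL : 0 ≤ L) {j : ℕ} {c d : List (ℕ → ℤ) → ZMod 2}
    (h : ∀ l, IsBoxSimplex L j l → c l = d l) : boxSum L j c = boxSum L j d := by
  induction j generalizing c d with
  | zero =>
    apply h
    refine ⟨rfl, ?_, ?_⟩ <;> simp [hL]
  | succ j ih =>
    simp only [boxSum]
    refine Finset.sum_congr rfl fun s hs => ih fun l hl => ?_
    exact prism_congr_of_isBoxSimplex hs hl h

theorem boxSum_add (L : ℤ) (j : ℕ) (c d : List (ℕ → ℤ) → ZMod 2) :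
    boxSum L j (fun l => c l + d l) = boxSum L j c + boxSum L j d := by
  induction j generalizing c d with
  | zero => rfl
  | succ j ih => simp only [boxSum, prism_add, ih, Finset.sum_add_distrib]

theorem boxSum_zero (L : ℤ) (j : ℕ) : boxSum L j (fun _ => 0) = 0 := by
  induction j with
  | zero => rfl
  | succ j ih => simp only [boxSum, prism_zero, ih, Finset.sum_const_zero]

theorem sum_Ico_add_succ (F : ℤ → ZMod 2) (a : ℤ) (n : ℕ) :
    ∑ s ∈ Finset.Ico a (a + n), (F s + F (s + 1)) = F a + F (a + n) := by
  have two : (2 : ZMod 2) = 0 := rfl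
  induction n with
  | zero =>
    simp only [Nat.cast_zero, add_zero, Finset.Ico_self, Finset.sum_empty]
    linear_combination - F a * two
  | succ n ih =>
    have : Finset.Ico a (a + ((n + 1 : ℕ) : ℤ)) = insert (a + (n : ℤ)) (Finset.Ico a (a + n)) := by
      ext x; simp only [Finset.mem_Ico, Finset.mem_insert]; push_cast; omega
    rw [this, Finset.sum_insert (by simp), ih]
    push_cast
    rw [← add_assoc a]
    linear_combination F (a + n) * two

/-- Summing a coboundary over a half-open stack of prisms. -/
theorem sum_boxSum_prism_cobdry (L : ℤ) (j : ℕ) (a : ℤ) (n : ℕ) (d : List (ℕ → ℤ) → ZMod 2)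
    (hd : ∀ s, boxSum L j (fun l => cobdry l (fun x => prism j s x d)) = 0) :
    ∑ s ∈ Finset.Ico a (a + n), boxSum L j (fun l => prism j s l (fun x => cobdry x d)) =
      boxSum L j (fun l => d (l.map (fun v => Function.update v j a))) +
      boxSum L j (fun l => d (l.map (fun v => Function.update v j (a + n)))) := by
  simp only [prism_cobdry, boxSum_add, hd, zero_add]
  exact sum_Ico_add_succ
    (fun s => boxSum L j (fun l => d (l.map (fun v => Function.update v j s)))) a n

theorem boxSum_cobdry_eq_zero {L : ℤ} (hL : 0 ≤ L) (j : ℕ) (d : List (ℕ → ℤ) → ZMod 2)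
    (h0 : d [] = 0)
    (hd : ∀ l, ∀ i < j, (∀ v ∈ l, |v i| = L) → d l = 0) :
    boxSum L j (fun l => cobdry l d) = 0 := by
  induction j generalizing d with
  | zero => simpa [boxSum, cobdry] using h0
  | succ j ih =>
    have key : ∀ s, boxSum L j (fun l => cobdry l (fun x => prism j s x d)) = 0 := by
      intro s
      apply ih _ rfl
      intro l i hi hl
      rw [← prism_zero j s l]
      apply prism_congr
      intro x _ hx
      apply hd _ i (by omega)
      intro v hv
      obtain ⟨q, hq, rfl | rfl⟩ := hx v hv
      · rw [Function.update_of_ne (by omega)]; exact hl q hq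
      · rw [Function.update_of_ne (by omega)]; exact hl q hq
    have side : ∀ t, |t| = L →
        boxSum L j (fun l => d (l.map (fun v => Function.update v j t))) = 0 := by
      intro t ht
      have : (fun l : List (ℕ → ℤ) => d (l.map (fun v => Function.update v j t))) =
          fun _ => 0 := by
        funext l
        apply hd _ j (by omega)
        intro v hv
        obtain ⟨q, _, rfl⟩ := List.mem_map.1 hv
        simpa using ht
      rw [this, boxSum_zero]
    have e := sum_boxSum_prism_cobdry L j (-L) (2 * L).toNat d key
    have e2 : -L + ((2 * L).toNat : ℤ) = L := by omega
    rw [e2] at e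
    simp only [boxSum]
    rw [e, side _ (by rw [abs_neg, abs_of_nonneg hL]), side _ (abs_of_nonneg hL), add_zero]

theorem sum_Ico_boxSum_antiSimplex (L : ℤ) (j : ℕ) (a b : ℤ) (c : List (ℕ → ℤ) → ZMod 2)
    (h : ∀ d : List (ℕ → ℤ) → ZMod 2, boxSum L j (fun l => d (antiSimplex l)) = boxSum L j d) :
    ∑ s ∈ Finset.Ico a b, boxSum L j (fun l => prism j s l (fun x => c (antiSimplex x))) =
      ∑ s ∈ Finset.Ico (-b) (-a), boxSum L j (fun l => prism j s l c) := by
  refine Finset.sum_nbij' (fun s => -s - 1) (fun s => -s - 1) ?_ ?_ ?_ ?_ ?_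
  · intro s hs; rw [Finset.mem_Ico] at hs ⊢; omega
  · intro s hs; rw [Finset.mem_Ico] at hs ⊢; omega
  · intro s _; ring
  · intro s _; ring
  · intro s _
    simp only [prism_antiSimplex]
    exact h (fun l => prism j (-s - 1) l c)

theorem boxSum_antiSimplex (L : ℤ) (j : ℕ) (c : List (ℕ → ℤ) → ZMod 2) :
    boxSum L j (fun l => c (antiSimplex l)) = boxSum L j c := by
  induction j generalizing c with
  | zero => simp [boxSum, antiSimplex]
  | succ j ih =>
    simp only [boxSum]
    rw [sum_Ico_boxSum_antiSimplex L j _ _ c ih, neg_neg]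

/-- A combinatorial Borsuk–Ulam lemma of Tucker–Fan type: an antipodal labelling of a cube with
indices `0, …, m`, where the index `0` stands for an even function which is positive on the
boundary and negative at the origin, has two neighbouring vertices with opposite labels. -/
theorem exists_opposite_labels (m : ℕ) (L : ℤ) (hL : 1 ≤ L) (lam : (ℕ → ℤ) → ℕ × Bool)
    (hidx : ∀ v, (lam v).1 ≤ m) (hanti : ∀ v, lam (-v) = antiLabel (lam v))
    (hbd : ∀ v, ∀ i ≤ m, |v i| = L → lam v = (0, true)) (h0 : lam 0 ≠ (0, true)) :
    ∃ v w : ℕ → ℤ, (∀ i, |v i| ≤ L) ∧ (∀ i, |w i| ≤ L) ∧ (∀ i, |v i - w i| ≤ 1) ∧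
      (lam v).1 = (lam w).1 ∧ lam v ≠ lam w := by
  by_contra hcon
  have hno : ∀ j l, IsBoxSimplex L j l → NoOpposite (l.map lam) := by
    intro j l ⟨_, h2, h3⟩ x hx y hy hxy
    obtain ⟨v, hv, rfl⟩ := List.mem_map.1 hx
    obtain ⟨w, hw, rfl⟩ := List.mem_map.1 hy
    by_contra hne
    exact hcon ⟨v, w, fun i => (h2 v hv i).1, fun i => (h2 w hw i).1, h3 v hv w hw, hxy, hne⟩
  set c : List (ℕ → ℤ) → ZMod 2 := fun l => fanCochain m true (l.map lam) with hc
  have hcb : ∀ l : List (ℕ → ℤ), l.length ≠ 1 → ∀ i ≤ m, (∀ v ∈ l, |v i| = L) → c l = 0 := by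
    intro l hl1 i hi hl
    apply fanCochain_eq_zero_of_forall
    · simpa using hl1
    · intro x hx
      obtain ⟨v, hv, rfl⟩ := List.mem_map.1 hx
      exact hbd v i hi (hl v hv)
  have hcob : ∀ j l, IsBoxSimplex L j l → c (antiSimplex l) + c l = cobdry l c := by
    intro j l hl
    have e1 : (antiSimplex l).map lam = ((l.map lam).map antiLabel).reverse := by
      simp [antiSimplex, List.map_reverse, Function.comp_def, hanti]
    rw [hc]
    simp only
    rw [e1, fanCochain_reverse, fanCochain_map_antiLabel, cobdry_map lam l (fanCochain m true),
      cobdry_fanCochain m true _ (hno j l hl), add_comm]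
    intro x hx
    obtain ⟨v, hv, rfl⟩ := List.mem_map.1 hx
    exact hidx v
  have step : ∀ j ≤ m, boxSum L (j + 1) c = boxSum L j c +
      boxSum L j (fun l => c (l.map (fun v => Function.update v j L))) := by
    intro j hj
    have hsplit : Finset.Ico (-L) L = Finset.Ico (-L) (-0) ∪ Finset.Ico 0 L := by
      ext x; simp only [Finset.mem_Ico, Finset.mem_union]; omega
    have hdisj : Disjoint (Finset.Ico (-L) (-0)) (Finset.Ico 0 L) := by
      rw [Finset.disjoint_left]; intro x; simp only [Finset.mem_Ico]; omega
    have key : ∀ s, boxSum L j (fun l => cobdry l (fun x => prism j s x c)) = 0 := by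
      intro s
      apply boxSum_cobdry_eq_zero (by omega) _ _ rfl
      intro l i hi hl
      rcases l with _ | ⟨a, l⟩
      · rfl
      rw [← prism_zero j s (a :: l)]
      apply prism_congr
      intro x hxl hx
      apply hcb _ (by simp only [List.length_cons] at hxl; omega) i (by omega)
      intro v hv
      obtain ⟨q, hq, rfl | rfl⟩ := hx v hv
      · rw [Function.update_of_ne (by omega)]; exact hl q hq
      · rw [Function.update_of_ne (by omega)]; exact hl q hq
    calc boxSum L (j + 1) c = ∑ s ∈ Finset.Ico 0 L,
          boxSum L j (fun l => prism j s l (fun x => cobdry x c)) := by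
          simp only [boxSum]
          rw [hsplit, Finset.sum_union hdisj,
            ← sum_Ico_boxSum_antiSimplex L j 0 L c (boxSum_antiSimplex L j),
            ← Finset.sum_add_distrib]
          refine Finset.sum_congr rfl fun s hs => ?_
          rw [← boxSum_add]
          refine boxSum_congr (by omega) fun l hl => ?_
          rw [← prism_add]
          refine prism_congr_of_isBoxSimplex ?_ hl (hcob (j + 1))
          rw [Finset.mem_Ico] at hs ⊢
          omega
      _ = _ := by
          have e := sum_boxSum_prism_cobdry L j 0 L.toNat c key
          have e2 : 0 + (L.toNat : ℤ) = L := by omega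
          rw [e2] at e
          rw [e]
          congr 1
          refine boxSum_congr (by omega) fun l hl => ?_
          congr 1
          conv_rhs => rw [← List.map_id l]
          refine List.map_congr_left fun v hv => ?_
          rw [← (hl.2.1 v hv j).2 le_rfl]
          simp
  have hone : ∀ j ≤ m, boxSum L (j + 1) c = 1 := by
    intro j
    induction j with
    | zero =>
      intro hj
      rw [step 0 hj]
      have e1 : boxSum L 0 c = 0 := fanCochain_singleton_ne m true _ h0
      have e2 : boxSum L 0 (fun l => c (l.map (fun v => Function.update v 0 L))) =
          fanCochain m true [lam (Function.update 0 0 L)] := rfl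
      rw [e1, e2, hbd _ 0 hj (by simp; omega), fanCochain_top, zero_add]
    | succ j ih =>
      intro hj
      rw [step _ hj, ih (by omega)]
      have : boxSum L (j + 1) (fun l => c (l.map (fun v => Function.update v (j + 1) L))) =
          boxSum L (j + 1) (fun _ => 0) := by
        refine boxSum_congr (by omega) fun l hl => ?_
        apply hcb _ _ (j + 1) hj
        · intro v hv
          obtain ⟨q, _, rfl⟩ := List.mem_map.1 hv
          simp; omega
        · have := hl.1
          simp; omega
      rw [this, boxSum_zero, add_zero]
  have hzero : boxSum L (m + 1) c = 0 := by
    rw [← boxSum_zero L (m + 1)]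
    refine boxSum_congr (by omega) fun l hl => ?_
    apply fanCochain_eq_zero_of_length
    have := hl.1
    simp; omega
  rw [hone m le_rfl] at hzero
  exact one_ne_zero hzero

/-- The least index at which `|f i|`, `i ≤ m`, is maximal. -/
def topIndex (m : ℕ) (f : ℕ → ℝ) : ℕ := sInf {i | i ≤ m ∧ ∀ j ≤ m, |f j| ≤ |f i|}

theorem topIndex_spec (m : ℕ) (f : ℕ → ℝ) :
    topIndex m f ≤ m ∧ ∀ j ≤ m, |f j| ≤ |f (topIndex m f)| := by
  have : {i | i ≤ m ∧ ∀ j ≤ m, |f j| ≤ |f i|}.Nonempty := by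
    obtain ⟨i, hi, h⟩ := Finset.exists_max_image (Finset.range (m + 1)) (fun i => |f i|) (by simp)
    refine ⟨i, by simpa [Nat.lt_succ_iff] using hi, fun j hj => h j (by simp; omega)⟩
  exact Nat.sInf_mem this

/-- The label of a value of a map whose component `0` is even, the other ones being odd. -/
def topLabel (m : ℕ) (f : ℕ → ℝ) : ℕ × Bool := (topIndex m f, decide (0 < f (topIndex m f)))

theorem topLabel_anti (m : ℕ) (f g : ℕ → ℝ) (h0 : g 0 = f 0) (h : ∀ i, i ≠ 0 → g i = -f i) :
    topLabel m g = antiLabel (topLabel m f) := by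
  have habs : ∀ i, |g i| = |f i| := by
    intro i
    rcases eq_or_ne i 0 with rfl | hi
    · rw [h0]
    · rw [h i hi, abs_neg]
  have hi : topIndex m g = topIndex m f := by simp only [topIndex, habs]
  unfold topLabel antiLabel
  rw [hi]
  simp only
  split_ifs with hz
  · rw [hz, h0]
  · rw [h _ hz]
    congr 1
    have hne : f (topIndex m f) ≠ 0 := by
      intro hf
      apply hz
      have hs := (topIndex_spec m f).2
      rw [hf, abs_zero] at hs
      have : (0 : ℕ) ∈ {i | i ≤ m ∧ ∀ j ≤ m, |f j| ≤ |f i|} :=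
        ⟨Nat.zero_le _, fun j hj => (hs j hj).trans (abs_nonneg _)⟩
      exact Nat.le_zero.1 (Nat.sInf_le this)
    rcases lt_or_gt_of_ne hne with h1 | h1
    · simp [h1, h1.le]
    · simp [h1, h1.le]

/-- The cube `[-R, R]^(m+1)` as a set of sequences. -/
def cube (m : ℕ) (R : ℝ) : Set (ℕ → ℝ) := {x | ∀ i, |x i| ≤ R ∧ (m < i → x i = 0)}

theorem isCompact_cube (m : ℕ) (R : ℝ) : IsCompact (cube m R) := by
  have hcl : IsClosed (cube m R) := by
    simp only [cube, ofPred_forall, ofPred_and]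
    refine isClosed_iInter fun i => IsClosed.inter ?_ ?_
    · exact isClosed_le (by fun_prop) continuous_const
    · by_cases h : m < i
      · simpa [h] using isClosed_eq (continuous_apply i) continuous_const
      · simp [h]
  refine (isCompact_univ_pi fun _ : ℕ => isCompact_Icc (a := -R) (b := R)).of_isClosed_subset hcl ?_
  intro x hx i _
  exact abs_le.1 (hx i).1

/-- Rescale an integer point to the cube of side `R`. -/
def gridPoint (m : ℕ) (R : ℝ) (L : ℤ) (v : ℕ → ℤ) : ℕ → ℝ := fun i =>
  if i ≤ m then max (-R) (min R (v i * (R / L))) else 0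

theorem gridPoint_mem {m : ℕ} {R : ℝ} (hR : 0 ≤ R) (L : ℤ) (v : ℕ → ℤ) :
    gridPoint m R L v ∈ cube m R := by
  intro i
  simp only [gridPoint]
  refine ⟨?_, fun h => if_neg (by omega)⟩
  split_ifs
  · exact abs_le.2 ⟨le_max_left _ _, max_le (by linarith) (min_le_left _ _)⟩
  · simpa using hR

theorem gridPoint_neg {m : ℕ} {R : ℝ} (hR : 0 ≤ R) (L : ℤ) (v : ℕ → ℤ) :
    gridPoint m R L (-v) = -gridPoint m R L v := by
  funext i
  simp only [gridPoint, Pi.neg_apply, Int.cast_neg, neg_mul]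
  split_ifs
  · rw [min_def, min_def, max_def, max_def]
    split_ifs <;> linarith
  · simp

theorem exists_zero_of_even_of_odd (m : ℕ) {R : ℝ} (hR : 0 < R) (K : (ℕ → ℝ) → ℕ → ℝ)
    (hK : ∀ i, Continuous fun x => K x i) (heven : ∀ x, K (-x) 0 = K x 0)
    (hodd : ∀ x, ∀ i, i ≠ 0 → K (-x) i = -K x i) (h0 : K 0 0 < 0)
    (hbd : ∀ x ∈ cube m R, ∀ i ≤ m, |x i| = R → 0 < K x 0) :
    ∃ x ∈ cube m R, ∀ i ≤ m, K x i = 0 := by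
  obtain ⟨M, hM, hMb⟩ : ∃ M : ℝ, 0 < M ∧ ∀ x ∈ cube m R, ∀ i ≤ m, |x i| = R →
      ∀ j ≤ m, |K x j| < M * K x 0 := by
    have hcpt : IsCompact (cube m R ∩ ⋃ i ∈ Finset.range (m + 1), {x : ℕ → ℝ | |x i| = R}) := by
      refine (isCompact_cube m R).inter_right ?_
      exact isClosed_biUnion_finset fun i _ => isClosed_eq (by fun_prop) continuous_const
    have hpos : ∀ x ∈ cube m R ∩ ⋃ i ∈ Finset.range (m + 1), {x : ℕ → ℝ | |x i| = R},
        0 < K x 0 := by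
      rintro x ⟨hx, hx2⟩
      simp only [mem_iUnion, Finset.mem_range, mem_ofPred_eq, exists_prop] at hx2
      obtain ⟨i, hi, h⟩ := hx2
      exact hbd x hx i (by omega) h
    have hcont : ContinuousOn (fun x => (∑ i ∈ Finset.range (m + 1), |K x i|) / K x 0)
        (cube m R ∩ ⋃ i ∈ Finset.range (m + 1), {x : ℕ → ℝ | |x i| = R}) := by
      refine ContinuousOn.div ?_ (hK 0).continuousOn fun x hx => (hpos x hx).ne'
      exact (continuous_finsetSum _ fun i _ => (hK i).abs).continuousOn
    obtain ⟨C, hC⟩ := hcpt.exists_bound_of_continuousOn hcont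
    refine ⟨|C| + 1, by positivity, fun x hx i hi hxi j hj => ?_⟩
    have hmem : x ∈ cube m R ∩ ⋃ i ∈ Finset.range (m + 1), {x : ℕ → ℝ | |x i| = R} := by
      refine ⟨hx, ?_⟩
      simp only [mem_iUnion, Finset.mem_range, mem_ofPred_eq, exists_prop]
      exact ⟨i, by omega, hxi⟩
    have h1 := (le_abs_self _).trans ((hC x hmem).trans (le_abs_self C))
    have h2 := hpos x hmem
    rw [div_le_iff₀ h2] at h1
    have h3 : |K x j| ≤ ∑ i ∈ Finset.range (m + 1), |K x i| :=
      Finset.single_le_sum (f := fun i => |K x i|) (fun i _ => abs_nonneg _) (by simp; omega)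
    nlinarith
  set F : (ℕ → ℝ) → ℕ → ℝ := fun x i => if i = 0 then M * K x 0 else K x i with hF
  have hF0 : ∀ x, F x 0 = M * K x 0 := fun x => if_pos rfl
  have hFs : ∀ x i, i ≠ 0 → F x i = K x i := fun x i h => if_neg h
  have hFc : ∀ i, Continuous fun x => F x i := by
    intro i
    simp only [hF]
    split_ifs
    · exact (hK 0).const_mul M
    · exact hK i
  have hFanti : ∀ x, topLabel m (F (-x)) = antiLabel (topLabel m (F x)) := by
    intro x
    apply topLabel_anti
    · simp [hF, heven]
    · intro i hi
      simp [hF, hi, hodd]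
  have hpair : ∀ N : ℕ, ∃ p : ((ℕ → ℝ) × ℕ) × (ℕ → ℝ), p.1.1 ∈ cube m R ∧ p.1.2 ≤ m ∧
      (∀ i, |p.1.1 i - p.2 i| ≤ R / (N + 1)) ∧ 0 ≤ F p.1.1 p.1.2 ∧ F p.2 p.1.2 ≤ 0 ∧
      ∀ j ≤ m, |F p.1.1 j| ≤ |F p.1.1 p.1.2| := by
    intro N
    obtain ⟨v, w, hv, hw, hvw, hl1, hl2⟩ := exists_opposite_labels m (N + 1 : ℤ) (by omega)
      (fun v => topLabel m (F (gridPoint m R (N + 1) v)))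
      (fun v => (topIndex_spec m _).1)
      (fun v => by simp only [gridPoint_neg hR.le, hFanti])
      (by
        intro v i hi hvi
        have hx : |gridPoint m R (N + 1) v i| = R := by
          simp only [gridPoint, if_pos hi]
          have hN : ((N : ℝ) + 1) ≠ 0 := by positivity
          rcases abs_eq (by omega : (0 : ℤ) ≤ N + 1) |>.1 hvi with h | h
          · rw [h]; push_cast
            rw [mul_div_cancel₀ _ hN, min_self, max_eq_right (by linarith), abs_of_pos hR]
          · rw [h]; push_cast
            rw [neg_mul, mul_div_cancel₀ _ hN, min_eq_right (by linarith), max_self, abs_neg,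
              abs_of_pos hR]
        have hb := hMb _ (gridPoint_mem hR.le (N + 1) v) i hi hx
        set x := gridPoint m R (N + 1) v
        have hpos : 0 < M * K x 0 := (abs_nonneg _).trans_lt (hb 0 (Nat.zero_le _))
        have hz : topIndex m (F x) = 0 := by
          by_contra hne
          have hs := topIndex_spec m (F x)
          have h1 := hs.2 0 (Nat.zero_le _)
          have h2 := hb _ hs.1
          rw [hFs _ _ hne, hF0, abs_of_pos hpos] at h1
          exact absurd h1 (not_le.2 h2)
        simp only [topLabel, hz]
        simp [hF, hpos])
      (by
        intro h
        have h2 := congrArg Prod.snd h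
        have hz : gridPoint m R (N + 1) 0 = 0 := by
          funext i
          simp only [gridPoint, Pi.zero_apply, Int.cast_zero, zero_mul]
          rw [min_eq_right hR.le, max_eq_right (by linarith)]
          simp
        simp only [topLabel, hz, decide_eq_true_eq] at h2
        by_cases hi : topIndex m (F 0) = 0
        · rw [hi, hF0] at h2
          exact absurd h2 (not_lt.2 (mul_nonpos_of_nonneg_of_nonpos hM.le h0.le))
        · rw [hFs _ _ hi] at h2
          have := hodd 0 _ hi
          simp only [neg_zero] at this
          linarith)
    have hdist : ∀ i, |gridPoint m R (N + 1) v i - gridPoint m R (N + 1) w i| ≤ R / (N + 1) := by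
      intro i
      simp only [gridPoint]
      have hN : (0 : ℝ) ≤ R / (N + 1) := by positivity
      split_ifs
      · refine (abs_max_sub_max_le_max _ _ _ _).trans (max_le (by simpa using hN) ?_)
        refine (abs_min_sub_min_le_max _ _ _ _).trans (max_le (by simpa using hN) ?_)
        push_cast
        rw [← sub_mul, abs_mul, abs_of_nonneg hN]
        have : |((v i : ℝ) - w i)| ≤ 1 := by exact_mod_cast hvw i
        nlinarith
      · simpa using hN
    set x := gridPoint m R (N + 1) v
    set y := gridPoint m R (N + 1) w
    simp only [topLabel] at hl1 hl2
    have hsx := topIndex_spec m (F x)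
    have hsy := topIndex_spec m (F y)
    rw [← hl1] at hsy hl2
    by_cases hpos : 0 < F x (topIndex m (F x))
    · refine ⟨((x, topIndex m (F x)), y), gridPoint_mem hR.le _ _, hsx.1, hdist, hpos.le, ?_, hsx.2⟩
      by_contra hcon
      apply hl2
      simp [hpos, not_le.1 hcon]
    · refine ⟨((y, topIndex m (F x)), x), gridPoint_mem hR.le _ _, hsx.1, ?_, ?_, not_lt.1 hpos,
        hsy.2⟩
      · intro i; rw [abs_sub_comm]; exact hdist i
      · by_contra hcon
        apply hl2
        simp [hpos, not_lt.2 (not_le.1 hcon).le]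
  choose p hp1 hp2 hp3 hp4 hp5 hp6 using hpair
  have hcpt : IsCompact (cube m R ×ˢ (Set.Iic m)) :=
    (isCompact_cube m R).prod (Set.finite_Iic m).isCompact
  obtain ⟨⟨x, i⟩, hxi, ψ, hψ, hlim⟩ := hcpt.tendsto_subseq (x := fun N => (p N).1)
    (fun N => ⟨hp1 N, hp2 N⟩)
  have hx : Tendsto (fun N => (p (ψ N)).1.1) atTop (𝓝 x) :=
    (continuous_fst.tendsto _).comp hlim
  have hi : ∀ᶠ N in atTop, (p (ψ N)).1.2 = i := by
    have : Tendsto (fun N => (p (ψ N)).1.2) atTop (𝓝 i) := (continuous_snd.tendsto _).comp hlim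
    rwa [nhds_discrete, tendsto_pure] at this
  have hy : Tendsto (fun N => (p (ψ N)).2) atTop (𝓝 x) := by
    rw [tendsto_pi_nhds] at hx ⊢
    intro j
    have h1 : Tendsto (fun N : ℕ => R / ((ψ N : ℝ) + 1)) atTop (𝓝 0) := by
      have : Tendsto (fun N : ℕ => R / ((N : ℝ) + 1)) atTop (𝓝 0) :=
        tendsto_const_nhds.div_atTop (tendsto_atTop_add_const_right _ _ tendsto_natCast_atTop_atTop)
      exact this.comp hψ.tendsto_atTop
    have h2 : Tendsto (fun N => (p (ψ N)).1.1 j - (p (ψ N)).2 j) atTop (𝓝 0) :=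
      squeeze_zero_norm (fun N => hp3 (ψ N) j) h1
    simpa using (hx j).sub h2
  have hFx : F x i = 0 := by
    apply le_antisymm
    · refine le_of_tendsto (((hFc i).tendsto x).comp hy) ?_
      filter_upwards [hi] with N hN
      rw [← hN]; exact hp5 _
    · refine ge_of_tendsto (((hFc i).tendsto x).comp hx) ?_
      filter_upwards [hi] with N hN
      rw [← hN]; exact hp4 _
  refine ⟨x, hxi.1, fun j hj => ?_⟩
  have hFj : F x j = 0 := by
    have : |F x j| ≤ |F x i| := by
      refine le_of_tendsto_of_tendsto (((hFc j).abs.tendsto x).comp hx)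
        (((hFc i).abs.tendsto x).comp hx) ?_
      filter_upwards [hi] with N hN
      simp only [Function.comp]
      rw [← hN]; exact hp6 _ j hj
    rw [hFx, abs_zero] at this
    exact abs_eq_zero.1 (le_antisymm this (abs_nonneg _))
  simp only [hF] at hFj
  split_ifs at hFj with h
  · subst h
    exact (mul_eq_zero.1 hFj).resolve_left hM.ne'
  · exact hFj

/-- The closed ball of radius `ρ` of `ℓ²`, as a set of sequences. -/
def seqBall (ρ : ℝ) : Set (ℕ → ℝ) := {a | ∀ n, ∑ i ∈ Finset.range n, a i ^ 2 ≤ ρ ^ 2}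

theorem isCompact_seqBall (ρ : ℝ) : IsCompact (seqBall ρ) := by
  have hcl : IsClosed (seqBall ρ) := by
    simp only [seqBall, ofPred_forall]
    refine isClosed_iInter fun n => isClosed_le ?_ continuous_const
    exact continuous_finsetSum _ fun i _ => by fun_prop
  refine (isCompact_univ_pi fun _ : ℕ => isCompact_Icc (a := -|ρ|) (b := |ρ|)).of_isClosed_subset
    hcl ?_
  intro a ha i _
  refine abs_le.1 (sq_le_sq.1 (le_trans ?_ (ha (i + 1))))
  exact Finset.single_le_sum (f := fun i => a i ^ 2) (fun i _ => sq_nonneg _) (by simp)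

theorem neg_mem_seqBall {ρ : ℝ} {a : ℕ → ℝ} (ha : a ∈ seqBall ρ) : -a ∈ seqBall ρ := by
  intro n
  simpa using ha n

theorem summable_sq_of_mem_seqBall {ρ : ℝ} {a : ℕ → ℝ} (ha : a ∈ seqBall ρ) :
    Summable fun i => a i ^ 2 :=
  summable_of_sum_range_le (fun _ => sq_nonneg _) ha

section Link

variable {X : Type*} [NormedAddCommGroup X] [InnerProductSpace ℝ X]

/-- The vector with coordinates `a` with respect to `g`. -/
def synth (g : ℕ → X) (a : ℕ → ℝ) : X := ∑' i, a i • g i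

theorem hasSum_synth [CompleteSpace X] {g : ℕ → X} (hg : Orthonormal ℝ g) {ρ : ℝ} {a : ℕ → ℝ}
    (ha : a ∈ seqBall ρ) : HasSum (fun i => a i • g i) (synth g a) := by
  have h := (hg.orthogonalFamily.summable_iff_norm_sq_summable a).2
    (by simpa using summable_sq_of_mem_seqBall ha)
  exact h.hasSum

theorem inner_synth [CompleteSpace X] {g : ℕ → X} (hg : Orthonormal ℝ g) {ρ : ℝ} {a : ℕ → ℝ}
    (ha : a ∈ seqBall ρ) (j : ℕ) : ⟪synth g a, g j⟫ = a j := by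
  have h := (hasSum_synth hg ha).mapL (innerSL ℝ (g j))
  have h2 : HasSum (fun i => innerSL ℝ (g j) (a i • g i)) (a j) := by
    have := hasSum_single (f := fun i => innerSL ℝ (g j) (a i • g i)) j (by
      intro i hi
      simp [hg.2 hi.symm])
    simpa [inner_smul_right, hg.1 j] using this
  rw [real_inner_comm]
  exact h.unique h2

theorem norm_sum_range_sq {g : ℕ → X} (hg : Orthonormal ℝ g) (a : ℕ → ℝ) (n : ℕ) :
    ‖∑ i ∈ Finset.range n, a i • g i‖ ^ 2 = ∑ i ∈ Finset.range n, a i ^ 2 := by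
  rw [← real_inner_self_eq_norm_sq, hg.inner_sum]
  exact Finset.sum_congr rfl fun i _ => by simp [sq]

theorem norm_synth_le [CompleteSpace X] {g : ℕ → X} (hg : Orthonormal ℝ g) {ρ : ℝ} (hρ : 0 ≤ ρ) {a : ℕ → ℝ}
    (ha : a ∈ seqBall ρ) : ‖synth g a‖ ≤ ρ := by
  refine le_of_tendsto (hasSum_synth hg ha).tendsto_sum_nat.norm (Eventually.of_forall fun n => ?_)
  refine abs_le_of_sq_le_sq' ?_ hρ |>.2
  rw [norm_sum_range_sq hg]
  exact ha n

theorem synth_neg (g : ℕ → X) (a : ℕ → ℝ) : synth g (-a) = -synth g a := by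
  simp [synth, tsum_neg]

theorem synth_eq_sum (g : ℕ → X) {a : ℕ → ℝ} {n : ℕ} (h : ∀ i, n ≤ i → a i = 0) :
    synth g a = ∑ i ∈ Finset.range n, a i • g i :=
  tsum_eq_sum fun i hi => by rw [h i (by simpa using hi), zero_smul]

/-- The map `synth g` is continuous from a ball with the product topology to the weak topology. -/
theorem continuous_inner_synth [CompleteSpace X] {g : ℕ → X} (hg : Orthonormal ℝ g) {ρ : ℝ} (hρ : 0 ≤ ρ) (w : X) :
    Continuous fun a : seqBall ρ => ⟪synth g a, w⟫ := by
  set V : Submodule ℝ X :=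
    { carrier := {w | Continuous fun a : seqBall ρ => ⟪synth g a, w⟫}
      add_mem' := by
        intro v w hv hw
        have : Continuous fun a : seqBall ρ => ⟪synth g a, v⟫ + ⟪synth g a, w⟫ := hv.add hw
        simpa only [Set.mem_ofPred_eq, inner_add_right] using this
      zero_mem' := by simpa using continuous_const
      smul_mem' := by
        intro c w hw
        have : Continuous fun a : seqBall ρ => c * ⟪synth g a, w⟫ := hw.const_mul c
        simpa only [Set.mem_ofPred_eq, inner_smul_right] using this } with hV
  have hcl : IsClosed (V : Set X) := by
    refine isClosed_of_closure_subset fun w hw => ?_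
    obtain ⟨v, hv, hlim⟩ := mem_closure_iff_seq_limit.1 hw
    have hun : TendstoUniformly (fun n (a : seqBall ρ) => ⟪synth g a, v n⟫)
        (fun a => ⟪synth g a, w⟫) atTop := by
      rw [Metric.tendstoUniformly_iff]
      intro ε hε
      have h := Metric.tendsto_atTop.1 hlim (ε / (ρ + 1)) (by positivity)
      obtain ⟨N, hN⟩ := h
      filter_upwards [eventually_ge_atTop N] with n hn a
      rw [Real.dist_eq, ← inner_sub_right]
      refine (abs_real_inner_le_norm _ _).trans_lt ?_
      have h1 := norm_synth_le hg hρ a.2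
      have h2 := hN n hn
      rw [dist_eq_norm, norm_sub_rev, lt_div_iff₀ (by positivity)] at h2
      nlinarith [norm_nonneg (w - v n)]
    exact hun.continuous (Frequently.of_forall fun n => hv n)
  have hgV : ∀ j, g j ∈ V := by
    intro j
    have : Continuous fun a : seqBall ρ => (a : ℕ → ℝ) j :=
      (continuous_apply j).comp continuous_subtype_val
    have h2 : (fun a : seqBall ρ => ⟪synth g a, g j⟫) = fun a : seqBall ρ => (a : ℕ → ℝ) j :=
      funext fun a => inner_synth hg a.2 j
    change Continuous fun a : seqBall ρ => ⟪synth g a, g j⟫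
    rwa [h2]
  have hort : ∀ v ∈ Vᗮ, v ∈ V := by
    intro v hv
    have : (fun a : seqBall ρ => ⟪synth g a, v⟫) = fun _ => 0 := by
      funext a
      have hmem : synth g a ∈ V := by
        refine hcl.mem_of_tendsto (hasSum_synth hg a.2).tendsto_sum_nat ?_
        exact Eventually.of_forall fun n => V.sum_mem fun i _ => V.smul_mem _ (hgV i)
      exact hv _ hmem
    change Continuous fun a : seqBall ρ => ⟪synth g a, v⟫
    rw [this]
    exact continuous_const
  have : CompleteSpace V := hcl.completeSpace_coe
  obtain ⟨y, hy, z, hz, rfl⟩ := V.exists_add_mem_mem_orthogonal w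
  exact V.add_mem hy (hort z hz)

/-- The parameter space of the deformations. -/
abbrev LinkDom (ρ : ℝ) : Type := ↥(seqBall ρ ×ˢ Icc (0 : ℝ) 1)

instance (ρ : ℝ) : CompactSpace (LinkDom ρ) :=
  isCompact_iff_compactSpace.1 ((isCompact_seqBall ρ).prod isCompact_Icc)

/-- The involution of the parameter space. -/
def LinkDom.flip {ρ : ℝ} (x : LinkDom ρ) : LinkDom ρ :=
  ⟨(-x.1.1, x.1.2), neg_mem_seqBall x.2.1, x.2.2⟩

theorem LinkDom.continuous_flip {ρ : ℝ} : Continuous (LinkDom.flip (ρ := ρ)) := by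
  unfold LinkDom.flip
  fun_prop

theorem tendsto_sum_inner [CompleteSpace X] {g : ℕ → X} (hg : Orthonormal ℝ g) {y : ℕ → X} {y₀ : X}
    (hy : Tendsto y atTop (𝓝 y₀)) {m : ℕ → ℕ} (hm : Tendsto m atTop atTop) :
    ∃ v, Tendsto (fun n => ∑ j ∈ Finset.range (m n), ⟪y n, g j⟫ • g j) atTop (𝓝 v) := by
  have hmem : ∀ z : X, (fun j => ⟪z, g j⟫) ∈ seqBall ‖z‖ := by
    intro z n
    have := hg.sum_inner_products_le z (s := Finset.range n)
    simpa [real_inner_comm] using this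
  refine ⟨synth g fun j => ⟪y₀, g j⟫, ?_⟩
  have h1 := (hasSum_synth hg (hmem y₀)).tendsto_sum_nat.comp hm
  have h2 : Tendsto (fun n => ∑ j ∈ Finset.range (m n), ⟪y n - y₀, g j⟫ • g j) atTop (𝓝 0) := by
    refine squeeze_zero_norm (a := fun n => ‖y n - y₀‖) (fun n => ?_) ?_
    · refine abs_le_of_sq_le_sq' ?_ (norm_nonneg _) |>.2
      rw [norm_sum_range_sq hg]
      exact hmem (y n - y₀) (m n)
    · simpa using (hy.sub_const y₀).norm
  have h3 := h2.add h1
  rw [zero_add] at h3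
  refine h3.congr fun n => ?_
  simp only [Function.comp, ← Finset.sum_add_distrib, ← add_smul, ← inner_add_left, sub_add_cancel]

theorem link_truncated {g : ℕ → X} (hg : Orthonormal ℝ g) {ρ r : ℝ} (hr : 0 < r) (hrρ : r < ρ)
    (G : C(LinkDom ρ, X)) (hodd : ∀ x, G x.flip = -G x) (hzero : ∀ x, x.1.2 = 0 → G x = 0)
    (m : ℕ) :
    ∃ x : LinkDom ρ, (x.1.2 = 1 ∨ ‖synth g x.1.1‖ = ρ) ∧ (∀ j, m < j → x.1.1 j = 0) ∧
      ‖synth g x.1.1 + G x‖ = r ∧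
      ∀ j, 1 ≤ j → j ≤ m → ⟪synth g x.1.1 + G x, g j⟫ = 0 := by
  have hρ : 0 < ρ := hr.trans hrρ
  set N : (ℕ → ℝ) → ℝ := fun x => √(∑ i ∈ Finset.range (m + 1), x i ^ 2) with hN
  have hNc : Continuous N := (continuous_finsetSum _ fun i _ => by fun_prop).sqrt
  have hNneg : ∀ x, N (-x) = N x := fun x => by simp [hN]
  have hN0 : ∀ x, 0 ≤ N x := fun x => Real.sqrt_nonneg _
  have hNsq : ∀ x, N x ^ 2 = ∑ i ∈ Finset.range (m + 1), x i ^ 2 := fun x =>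
    Real.sq_sqrt (Finset.sum_nonneg fun i _ => sq_nonneg _)
  set A : (ℕ → ℝ) → ℕ → ℝ := fun x i => if i ≤ m then ρ / max ρ (N x) * x i else 0 with hA
  have hmaxpos : ∀ x, 0 < max ρ (N x) := fun x => lt_max_of_lt_left hρ
  have hAc : Continuous A := by
    refine continuous_pi fun i => ?_
    simp only [hA]
    split_ifs
    · exact (continuous_const.div (continuous_const.max hNc) fun x => (hmaxpos x).ne').mul
        (continuous_apply i)
    · exact continuous_const
  have hA0 : ∀ x i, m < i → A x i = 0 := fun x i hi => if_neg (by omega)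
  have hAsum : ∀ x, ∑ i ∈ Finset.range (m + 1), A x i ^ 2 = (ρ / max ρ (N x) * N x) ^ 2 := by
    intro x
    rw [mul_pow, hNsq, Finset.mul_sum]
    refine Finset.sum_congr rfl fun i hi => ?_
    simp only [hA, if_pos (Nat.lt_succ_iff.1 (Finset.mem_range.1 hi)), mul_pow]
  have hAle : ∀ x, ρ / max ρ (N x) * N x ≤ ρ := by
    intro x
    rw [div_mul_eq_mul_div, div_le_iff₀ (hmaxpos x)]
    exact mul_le_mul_of_nonneg_left (le_max_right _ _) hρ.le
  have hAnn : ∀ x, 0 ≤ ρ / max ρ (N x) * N x := fun x =>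
    mul_nonneg (div_nonneg hρ.le (hmaxpos x).le) (hN0 x)
  have hAmem : ∀ x, A x ∈ seqBall ρ := by
    intro x n
    calc ∑ i ∈ Finset.range n, A x i ^ 2
        ≤ ∑ i ∈ Finset.range (max n (m + 1)), A x i ^ 2 :=
          Finset.sum_le_sum_of_subset_of_nonneg (by simp) fun i _ _ => sq_nonneg _
      _ = ∑ i ∈ Finset.range (m + 1), A x i ^ 2 := by
          symm
          refine Finset.sum_subset (by simp) fun i _ hi => ?_
          rw [hA0 x i (by simpa using hi)]; simp
      _ ≤ ρ ^ 2 := by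
          rw [hAsum]
          exact pow_le_pow_left₀ (hAnn x) (hAle x) 2
  have hAneg : ∀ x, A (-x) = -A x := by
    intro x
    funext i
    simp only [hA, hNneg, Pi.neg_apply]
    split_ifs <;> simp
  have hsyn : ∀ x, synth g (A x) = ∑ i ∈ Finset.range (m + 1), A x i • g i := fun x =>
    synth_eq_sum g fun i hi => hA0 x i hi
  have hnorm : ∀ x, ‖synth g (A x)‖ = ρ / max ρ (N x) * N x := by
    intro x
    rw [← sq_eq_sq₀ (norm_nonneg _) (hAnn x), hsyn, norm_sum_range_sq hg, hAsum]
  have hsc : Continuous fun x => synth g (A x) := by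
    simp only [hsyn]
    exact continuous_finsetSum _ fun i _ => ((continuous_apply i).comp hAc).smul continuous_const
  set T : (ℕ → ℝ) → ℝ := fun x => max 0 (min 1 (2 - N x / ρ)) with hT
  have hTc : Continuous T := by
    simp only [hT]
    exact continuous_const.max (continuous_const.min (continuous_const.sub (hNc.div_const ρ)))
  have hTmem : ∀ x, T x ∈ Icc (0 : ℝ) 1 := fun x =>
    ⟨le_max_left _ _, max_le zero_le_one (min_le_left _ _)⟩
  set B : (ℕ → ℝ) → LinkDom ρ := fun x => ⟨(A x, T x), hAmem x, hTmem x⟩ with hB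
  have hBc : Continuous B := (hAc.prodMk hTc).subtype_mk _
  have hBneg : ∀ x, B (-x) = (B x).flip := by
    intro x
    simp only [hB, LinkDom.flip, hAneg, hT, hNneg]
  set γ : (ℕ → ℝ) → X := fun x => synth g (A x) + G (B x) with hγ
  have hγc : Continuous γ := hsc.add (G.continuous.comp hBc)
  have hγneg : ∀ x, γ (-x) = -γ x := by
    intro x
    simp only [hγ, hBneg, hAneg, hodd, synth_neg]
    abel
  set K : (ℕ → ℝ) → ℕ → ℝ := fun x i => if i = 0 then ‖γ x‖ - r else ⟪γ x, g i⟫ with hK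
  have hK0 : ∀ x, K x 0 = ‖γ x‖ - r := fun x => if_pos rfl
  have hKs : ∀ x i, i ≠ 0 → K x i = ⟪γ x, g i⟫ := fun x i h => if_neg h
  obtain ⟨x, hx, hKx⟩ := exists_zero_of_even_of_odd m (R := 2 * ρ) (by positivity) K
    (by
      intro i
      simp only [hK]
      split_ifs
      · exact hγc.norm.sub continuous_const
      · exact hγc.inner continuous_const)
    (fun x => by rw [hK0, hK0, hγneg, norm_neg])
    (fun x i hi => by rw [hKs _ _ hi, hKs _ _ hi, hγneg, inner_neg_left])
    (by
      have h0 : γ 0 = 0 := by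
        have := hγneg 0
        rw [neg_zero] at this
        have h2 : (2 : ℝ) • γ 0 = 0 := by
          rw [two_smul]
          nth_rewrite 1 [this]
          exact neg_add_cancel _
        exact (smul_eq_zero.1 h2).resolve_left two_ne_zero
      rw [hK0, h0, norm_zero]
      linarith)
    (by
      intro x hx i hi hxi
      have hNx : 2 * ρ ≤ N x := by
        rw [← hxi]
        refine Real.abs_le_sqrt ?_
        exact Finset.single_le_sum (f := fun i => x i ^ 2) (fun i _ => sq_nonneg _)
          (by simp; omega)
      have hTx : T x = 0 := by
        have h1 : 2 ≤ N x / ρ := (le_div_iff₀ hρ).2 hNx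
        exact max_eq_left ((min_le_right _ _).trans (by linarith))
      have hGx : G (B x) = 0 := hzero _ hTx
      have hn : ‖γ x‖ = ρ := by
        simp only [hγ, hGx, add_zero, hnorm]
        rw [max_eq_right (by linarith)]
        exact div_mul_cancel₀ _ (by linarith)
      rw [hK0, hn]
      linarith)
  refine ⟨B x, ?_, hA0 x, ?_, ?_⟩
  · rcases le_or_gt (N x) ρ with h | h
    · left
      have h1 : N x / ρ ≤ 1 := (div_le_one hρ).2 h
      change max 0 (min 1 (2 - N x / ρ)) = 1
      rw [min_eq_left (by linarith), max_eq_right zero_le_one]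
    · right
      change ‖synth g (A x)‖ = ρ
      rw [hnorm, max_eq_right h.le]
      exact div_mul_cancel₀ _ (by linarith)
  · have := hKx 0 (Nat.zero_le _)
    rw [hK0] at this
    exact sub_eq_zero.1 this
  · intro j hj hjm
    have := hKx j hjm
    rwa [hKs _ _ (by omega)] at this

theorem exists_link [CompleteSpace X] {g : ℕ → X} (hg : Orthonormal ℝ g) {ρ r : ℝ} (hr : 0 < r) (hrρ : r < ρ)
    (G : C(LinkDom ρ, X)) (hodd : ∀ x, G x.flip = -G x) (hzero : ∀ x, x.1.2 = 0 → G x = 0)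
    (hbd : ∀ x : LinkDom ρ, ‖synth g x.1.1‖ = ρ → ‖synth g x.1.1 + G x‖ = r →
      (∀ j, 1 ≤ j → ⟪synth g x.1.1 + G x, g j⟫ = 0) → False) :
    ∃ x : LinkDom ρ, x.1.2 = 1 ∧ ‖synth g x.1.1 + G x‖ = r ∧
      ∀ j, 1 ≤ j → ⟪synth g x.1.1 + G x, g j⟫ = 0 := by
  have hρ : 0 ≤ ρ := (hr.trans hrρ).le
  choose x hx1 hx2 hx3 hx4 using link_truncated hg hr hrρ G hodd hzero
  obtain ⟨x₀, -, ψ, hψ, hlim⟩ := (isCompact_univ (X := LinkDom ρ)).tendsto_subseq (x := x)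
    (fun _ => mem_univ _)
  have hG : Tendsto (fun n => G (x (ψ n))) atTop (𝓝 (G x₀)) := (G.continuous.tendsto x₀).comp hlim
  have hco : ∀ j, Tendsto (fun n => (x (ψ n)).1.1 j) atTop (𝓝 (x₀.1.1 j)) := by
    intro j
    have : Continuous fun x : LinkDom ρ => x.1.1 j := by fun_prop
    exact (this.tendsto x₀).comp hlim
  have hsyn : ∀ n, synth g (x n).1.1 = ((x n).1.1 0 + ⟪G (x n), g 0⟫) • g 0 -
      ∑ j ∈ Finset.range (n + 1), ⟪G (x n), g j⟫ • g j := by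
    intro n
    rw [synth_eq_sum g (n := n + 1) (fun i hi => hx2 n i hi), Finset.sum_range_succ',
      Finset.sum_range_succ' (fun j => ⟪G (x n), g j⟫ • g j), add_smul]
    have : ∀ i ∈ Finset.range n, (x n).1.1 (i + 1) • g (i + 1) =
        -(⟪G (x n), g (i + 1)⟫ • g (i + 1)) := by
      intro i hi
      have h := hx4 n (i + 1) (by omega) (by simpa using hi)
      rw [inner_add_left, inner_synth hg (x n).2.1] at h
      rw [eq_neg_of_add_eq_zero_left h, neg_smul]
    rw [Finset.sum_congr rfl this, Finset.sum_neg_distrib]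
    abel
  obtain ⟨v, hv⟩ : ∃ v, Tendsto (fun n => synth g (x (ψ n)).1.1) atTop (𝓝 v) := by
    obtain ⟨v, hv⟩ := tendsto_sum_inner hg hG
      ((tendsto_add_atTop_nat 1).comp hψ.tendsto_atTop)
    refine ⟨_, ((((hco 0).add (hG.inner (tendsto_const_nhds (x := g 0)))).smul
      (tendsto_const_nhds (x := g 0))).sub hv).congr fun n => ?_⟩
    rw [hsyn]
    rfl
  have hvx : v = synth g x₀.1.1 := by
    refine ext_inner_right ℝ fun w => ?_
    have h1 : Tendsto (fun n => ⟪synth g (x (ψ n)).1.1, w⟫) atTop (𝓝 ⟪v, w⟫) :=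
      hv.inner tendsto_const_nhds
    have h2 : Continuous fun y : LinkDom ρ => ⟪synth g y.1.1, w⟫ :=
      (continuous_inner_synth hg hρ w).comp
        (by fun_prop : Continuous fun y : LinkDom ρ => (⟨y.1.1, y.2.1⟩ : seqBall ρ))
    exact tendsto_nhds_unique h1 ((h2.tendsto x₀).comp hlim)
  rw [hvx] at hv
  have hγ := hv.add hG
  have e1 : ‖synth g x₀.1.1 + G x₀‖ = r :=
    tendsto_nhds_unique hγ.norm (by simp only [hx3]; exact tendsto_const_nhds)
  have e2 : ∀ j, 1 ≤ j → ⟪synth g x₀.1.1 + G x₀, g j⟫ = 0 := by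
    intro j hj
    refine tendsto_nhds_unique (hγ.inner (tendsto_const_nhds (x := g j))) ?_
    refine tendsto_const_nhds.congr' ?_
    filter_upwards [hψ.tendsto_atTop.eventually_ge_atTop j] with n hn
    exact (hx4 _ j hj hn).symm
  have e3 : x₀.1.2 = 1 ∨ ‖synth g x₀.1.1‖ = ρ := by
    have hcl : IsClosed {p : ℝ × ℝ | p.1 = 1 ∨ p.2 = ρ} :=
      (isClosed_eq continuous_fst continuous_const).union
        (isClosed_eq continuous_snd continuous_const)
    have ht : Tendsto (fun n => (x (ψ n)).1.2) atTop (𝓝 x₀.1.2) := by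
      have : Continuous fun x : LinkDom ρ => x.1.2 := by fun_prop
      exact (this.tendsto x₀).comp hlim
    exact hcl.mem_of_tendsto (ht.prodMk_nhds hv.norm) (Eventually.of_forall fun n => hx1 _)
  exact ⟨x₀, e3.resolve_right fun h => hbd x₀ h e1 e2, e1, e2⟩

end Link

/-- Ekeland's variational principle. -/
theorem exists_ekeland {E : Type*} [MetricSpace E] [CompleteSpace E] [Nonempty E] {F : E → ℝ}
    (hF : LowerSemicontinuous F) (hb : BddBelow (range F)) {σ : ℝ} (hσ : 0 < σ) :
    ∃ x, ∀ y, F y + σ * dist x y ≤ F x → y = x := by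
  set S : E → Set E := fun x => {y | F y + σ * dist x y ≤ F x} with hS
  have hself : ∀ x, x ∈ S x := fun x => by simp [hS]
  have hmono : ∀ x, ∀ y ∈ S x, S y ⊆ S x := by
    intro x y hy z hz
    simp only [hS, mem_ofPred_eq] at hy hz ⊢
    nlinarith [dist_triangle x y z]
  have hbd : ∀ x, BddBelow (F '' S x) := fun x => hb.mono (image_subset_range _ _)
  have hstep : ∀ (n : ℕ) (x : E), ∃ y ∈ S x, ∀ z ∈ S y, σ * dist y z ≤ (1 / 2) ^ n := by
    intro n x
    obtain ⟨_, ⟨y, hy, rfl⟩, hlt⟩ := exists_lt_of_csInf_lt (s := F '' S x)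
      (b := sInf (F '' S x) + (1 / 2) ^ n) ⟨_, x, hself x, rfl⟩ (lt_add_of_pos_right _ (by positivity))
    refine ⟨y, hy, fun z hz => ?_⟩
    have h1 := csInf_le (hbd x) ⟨z, hmono x y hy hz, rfl⟩
    simp only [hS, mem_ofPred_eq] at hz
    linarith
  choose next hnext hsmall using hstep
  set x : ℕ → E := fun n => Nat.rec (Classical.arbitrary E) next n with hx
  have hxs : ∀ n, x (n + 1) = next n (x n) := fun n => rfl
  have hmem : ∀ n k, x (n + k) ∈ S (x n) := by
    intro n k
    induction k with
    | zero => exact hself _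
    | succ k ih => exact hmono _ _ ih (by rw [← add_assoc, hxs]; exact hnext _ _)
  have hdist : ∀ n, ∀ z ∈ S (x (n + 1)), dist (x (n + 1)) z ≤ (1 / 2) ^ n / σ := by
    intro n z hz
    rw [le_div_iff₀ hσ, mul_comm]
    exact hsmall n (x n) z hz
  have hlim0 : Tendsto (fun n : ℕ => (1 / 2 : ℝ) ^ n / σ) atTop (𝓝 0) := by
    simpa using (tendsto_pow_atTop_nhds_zero_of_lt_one (by norm_num : (0 : ℝ) ≤ 1 / 2)
      (by norm_num)).div_const σ
  have hcau : CauchySeq fun n => x (n + 1) := by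
    refine cauchySeq_of_le_tendsto_0' (fun n => (1 / 2) ^ n / σ) (fun n m hnm => ?_) hlim0
    obtain ⟨k, rfl⟩ := Nat.exists_eq_add_of_le hnm
    refine hdist n _ ?_
    have := hmem (n + 1) k
    rwa [show n + 1 + k = n + k + 1 by ring] at this
  obtain ⟨y, hy⟩ := cauchySeq_tendsto_of_complete hcau
  have hyS : ∀ n, y ∈ S (x n) := by
    intro n
    have hcl : IsClosed (S (x n)) := by
      have : LowerSemicontinuous fun z => F z + σ * dist (x n) z :=
        hF.add (by fun_prop : Continuous fun z => σ * dist (x n) z).lowerSemicontinuous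
      exact this.isClosed_preimage (F (x n))
    refine hcl.mem_of_tendsto hy ?_
    filter_upwards [eventually_ge_atTop n] with m hm
    obtain ⟨k, hk⟩ := Nat.exists_eq_add_of_le (hm.trans (Nat.le_succ m))
    rw [show m + 1 = n + k from hk]
    exact hmem n k
  refine ⟨y, fun z hz => ?_⟩
  have hzS : ∀ n, z ∈ S (x n) := fun n => hmono _ _ (hyS n) hz
  refine tendsto_nhds_unique ?_ hy
  rw [tendsto_iff_dist_tendsto_zero]
  exact squeeze_zero (fun _ => dist_nonneg) (fun n => hdist n z (hzS (n + 1))) hlim0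

section Descent

variable {X : Type*} [NormedAddCommGroup X] [InnerProductSpace ℝ X]

theorem exists_lt_norm_deriv {φ : X → ℝ} {φ' : X → X →L[ℝ] ℝ} (hφ : Continuous φ)
    (hC1 : Continuous φ')
    (hPS : ∀ c : ℝ, 0 < c → ∀ u : ℕ → X,
      Tendsto (fun n => φ (u n)) atTop (𝓝 c) →
      Tendsto (fun n => ‖φ' (u n)‖) atTop (𝓝 0) →
      ∃ ψ : ℕ → ℕ, StrictMono ψ ∧ ∃ v : X, Tendsto (fun n => u (ψ n)) atTop (𝓝 v))
    {m d : ℝ} (hm : 0 < m) (hcrit : ∀ v, m ≤ φ v → φ' v ≠ 0) :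
    ∃ δ, 0 < δ ∧ ∀ v, m ≤ φ v → φ v ≤ d → δ < ‖φ' v‖ := by
  by_contra! hcon
  choose u hu1 hu2 hu3 using fun n : ℕ => hcon (1 / ((n : ℝ) + 1)) (by positivity)
  obtain ⟨c, hc, ψ, hψ, hlim⟩ := (isCompact_Icc (a := m) (b := d)).tendsto_subseq
    (x := fun n => φ (u n)) (fun n => ⟨hu1 n, hu2 n⟩)
  have hz : Tendsto (fun n => ‖φ' (u (ψ n))‖) atTop (𝓝 0) :=
    (squeeze_zero (fun _ => norm_nonneg _) hu3 tendsto_one_div_add_atTop_nhds_zero_nat).comp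
      hψ.tendsto_atTop
  obtain ⟨η, hη, v, hv⟩ := hPS c (hm.trans_le hc.1) (fun n => u (ψ n)) hlim hz
  refine hcrit v ?_ ?_
  · rw [← tendsto_nhds_unique (hlim.comp hη.tendsto_atTop) ((hφ.tendsto v).comp hv)] at *
    exact hc.1
  · have := tendsto_nhds_unique (hz.comp hη.tendsto_atTop) ((hC1.norm.tendsto v).comp hv)
    exact norm_eq_zero.1 this.symm

theorem deriv_neg_of_even {φ : X → ℝ} {φ' : X → X →L[ℝ] ℝ} (hderiv : ∀ u, HasFDerivAt φ (φ' u) u)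
    (heven : ∀ u, φ (-u) = φ u) (u : X) : φ' (-u) = -φ' u := by
  have h1 : HasFDerivAt (fun v => φ (-v)) ((φ' (-u)).comp (-ContinuousLinearMap.id ℝ X)) u :=
    (hderiv (-u)).comp u (hasFDerivAt_id u).neg
  simp only [heven] at h1
  have h2 := h1.unique (hderiv u)
  rw [← h2]
  ext w
  simp

theorem sub_smul_le_of_le_deriv {φ : X → ℝ} {φ' : X → X →L[ℝ] ℝ}
    (hderiv : ∀ u, HasFDerivAt φ (φ' u) u) {v w : X} {κ h : ℝ}
    (hw : ∀ s ∈ Icc 0 h, κ ≤ φ' (v - s • w) w) {s : ℝ} (hs : s ∈ Icc 0 h) :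
    φ (v - s • w) ≤ φ v - κ * s := by
  have hd : ∀ s : ℝ, HasDerivAt (fun s : ℝ => φ (v - s • w)) (-(φ' (v - s • w) w)) s := by
    intro s
    have h1 : HasDerivAt (fun s : ℝ => v - s • w) (-((1 : ℝ) • w)) s :=
      ((hasDerivAt_id s).smul_const w).const_sub v
    have h2 := (hderiv (v - s • w)).comp_hasDerivAt s h1
    rw [one_smul, map_neg] at h2
    exact h2
  have := (convex_Icc (0 : ℝ) h).image_sub_le_mul_sub_of_deriv_le
    (f := fun s : ℝ => φ (v - s • w)) (C := -κ)
    (fun s _ => (hd s).continuousAt.continuousWithinAt)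
    (fun s _ => (hd s).differentiableAt.differentiableWithinAt)
    (fun s hs => by
      rw [(hd s).deriv]
      exact neg_le_neg (hw s (interior_subset hs)))
    0 ⟨le_rfl, hs.1.trans hs.2⟩ s hs hs.1
  simp only [zero_smul, sub_zero] at this
  linarith

/-- A field along which `φ'` is uniformly positive near the image of `γ`. -/
theorem exists_descent_field {D : Type*} [TopologicalSpace D] [CompactSpace D] [T2Space D]
    [FirstCountableTopology D] {φ : X → ℝ} {φ' : X → X →L[ℝ] ℝ} (hwsc : WeaklySeqContDeriv φ')
    {γ : D → X} (hγ : ∀ (y : ℕ → D) (x : D), Tendsto y atTop (𝓝 x) →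
      WeakConv (fun n => γ (y n)) (γ x))
    {m δ : ℝ} (hδ : 0 ≤ δ) (hcl : IsClosed {x | m ≤ φ (γ x)})
    (hnorm : ∀ x, m ≤ φ (γ x) → δ < ‖φ' (γ x)‖) :
    ∃ (V : C(D, X)) (h : ℝ), 0 < h ∧ ∀ x, ‖V x‖ ≤ 1 ∧ ∀ p, ‖p‖ ≤ h →
      0 ≤ φ' (γ x + p) (V x) ∧ (m ≤ φ (γ x) → δ ≤ φ' (γ x + p) (V x)) := by
  set t : ℝ → D → Set X := fun h x => {w | ‖w‖ ≤ 1 ∧ ∀ p, ‖p‖ ≤ h →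
      0 ≤ φ' (γ x + p) w ∧ (m ≤ φ (γ x) → δ ≤ φ' (γ x + p) w)} with ht
  have hanti : ∀ {h₁ h₂ : ℝ}, h₁ ≤ h₂ → ∀ x, t h₂ x ⊆ t h₁ x := fun hle x w hw =>
    ⟨hw.1, fun p hp => hw.2 p (hp.trans hle)⟩
  have hconv : ∀ h x, Convex ℝ (t h x) := by
    intro h x v hv w hw a b ha hb hab
    refine ⟨?_, fun p hp => ?_⟩
    · calc ‖a • v + b • w‖ ≤ ‖a • v‖ + ‖b • w‖ := norm_add_le _ _
        _ = a * ‖v‖ + b * ‖w‖ := by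
          rw [norm_smul, norm_smul, Real.norm_of_nonneg ha, Real.norm_of_nonneg hb]
        _ ≤ 1 := by nlinarith [hv.1, hw.1]
    · have h1 := hv.2 p hp
      have h2 := hw.2 p hp
      simp only [map_add, map_smul, smul_eq_mul]
      refine ⟨add_nonneg (mul_nonneg ha h1.1) (mul_nonneg hb h2.1), fun hm => ?_⟩
      have h3 := mul_le_mul_of_nonneg_left (h1.2 hm) ha
      have h4 := mul_le_mul_of_nonneg_left (h2.2 hm) hb
      calc δ = a * δ + b * δ := by rw [← add_mul, hab, one_mul]
        _ ≤ _ := add_le_add h3 h4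
  have hloc : ∀ x, ∃ h, 0 < h ∧ ∃ w, ∀ᶠ y in 𝓝 x, w ∈ t h y := by
    intro x
    by_cases hx : m ≤ φ (γ x)
    · obtain ⟨w, hw1, hw2⟩ : ∃ w, ‖w‖ ≤ 1 ∧ δ < φ' (γ x) w := by
        obtain ⟨w, hw, hlt⟩ := (φ' (γ x)).exists_lt_apply_of_lt_opNorm (hnorm x hx)
        rcases lt_abs.1 (by simpa using hlt : δ < |φ' (γ x) w|) with h | h
        · exact ⟨w, hw.le, h⟩
        · exact ⟨-w, by simpa using hw.le, by simpa using h⟩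
      have hlim : Tendsto (fun q : D × X => φ' (γ q.1 + q.2) w) (𝓝 x ×ˢ 𝓝 0)
          (𝓝 (φ' (γ x) w)) := by
        refine tendsto_of_seq_tendsto fun q hq => ?_
        refine hwsc (fun n => γ (q n).1 + (q n).2) (γ x) (fun v => ?_) w
        have h1 := hγ (fun n => (q n).1) x (tendsto_fst.comp hq) v
        have h2 : Tendsto (fun n => ⟪(q n).2, v⟫) atTop (𝓝 ⟪(0 : X), v⟫) :=
          (tendsto_snd.comp hq).inner tendsto_const_nhds
        simpa [inner_add_left] using h1.add h2
      have hev := hlim.eventually (lt_mem_nhds hw2)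
      obtain ⟨pa, hpa, pb, hpb, hab⟩ := eventually_prod_iff.1 hev
      obtain ⟨h, hh, hball⟩ := Metric.nhds_basis_closedBall.eventually_iff.1 hpb
      refine ⟨h, hh, w, hpa.mono fun y hy => ⟨hw1, fun p hp => ?_⟩⟩
      have := hab hy (hball (by simpa using hp))
      exact ⟨hδ.trans this.le, fun _ => this.le⟩
    · refine ⟨1, one_pos, 0, ?_⟩
      filter_upwards [hcl.isOpen_compl.mem_nhds hx] with y hy
      exact ⟨by simp, fun p _ => ⟨by simp, fun h => absurd h hy⟩⟩
  obtain ⟨h, hh, hunif⟩ : ∃ h, 0 < h ∧ ∀ x ∈ (univ : Set D), ∃ w, ∀ᶠ y in 𝓝 x, w ∈ t h y := by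
    refine (isCompact_univ (X := D)).induction_on
      (p := fun s => ∃ h, 0 < h ∧ ∀ x ∈ s, ∃ w, ∀ᶠ y in 𝓝 x, w ∈ t h y) ?_ ?_ ?_ ?_
    · exact ⟨1, one_pos, fun x hx => absurd hx (notMem_empty x)⟩
    · rintro s s' hss ⟨h, hh, H⟩
      exact ⟨h, hh, fun x hx => H x (hss hx)⟩
    · rintro s s' ⟨h, hh, H⟩ ⟨h', hh', H'⟩
      refine ⟨min h h', lt_min hh hh', ?_⟩
      rintro x (hx | hx)
      · obtain ⟨w, hw⟩ := H x hx
        exact ⟨w, hw.mono fun y hy => hanti (min_le_left _ _) y hy⟩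
      · obtain ⟨w, hw⟩ := H' x hx
        exact ⟨w, hw.mono fun y hy => hanti (min_le_right _ _) y hy⟩
    · intro x _
      obtain ⟨h, hh, w, hw⟩ := hloc x
      refine ⟨_, mem_nhdsWithin_of_mem_nhds (eventually_eventually_nhds.2 hw), h, hh, ?_⟩
      exact fun y hy => ⟨w, hy⟩
  obtain ⟨V, hV⟩ := exists_continuous_forall_mem_convex_of_local_const (hconv h)
    (fun x => hunif x (mem_univ x))
  exact ⟨V, h, hh, hV⟩

theorem exists_odd_descent_field {D : Type*} [TopologicalSpace D] [CompactSpace D] [T2Space D]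
    [FirstCountableTopology D] {φ : X → ℝ} {φ' : X → X →L[ℝ] ℝ} (hwsc : WeaklySeqContDeriv φ')
    (heven : ∀ u, φ (-u) = φ u) (hneg : ∀ u, φ' (-u) = -φ' u)
    {γ : D → X} (hγ : ∀ (y : ℕ → D) (x : D), Tendsto y atTop (𝓝 x) →
      WeakConv (fun n => γ (y n)) (γ x))
    {ι : D → D} (hι : Continuous ι) (hιι : ∀ x, ι (ι x) = x) (hγι : ∀ x, γ (ι x) = -γ x)
    {m δ : ℝ} (hδ : 0 ≤ δ) (hcl : IsClosed {x | m ≤ φ (γ x)})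
    (hnorm : ∀ x, m ≤ φ (γ x) → δ < ‖φ' (γ x)‖) :
    ∃ (V : C(D, X)) (h : ℝ), 0 < h ∧ (∀ x, V (ι x) = -V x) ∧ ∀ x, ‖V x‖ ≤ 1 ∧ ∀ p, ‖p‖ ≤ h →
      0 ≤ φ' (γ x + p) (V x) ∧ (m ≤ φ (γ x) → δ ≤ φ' (γ x + p) (V x)) := by
  obtain ⟨V, h, hh, hV⟩ := exists_descent_field hwsc hγ hδ hcl hnorm
  refine ⟨⟨fun x => (1 / 2 : ℝ) • (V x - V (ι x)), by fun_prop⟩, h, hh, fun x => ?_, fun x => ?_⟩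
  · simp only [ContinuousMap.coe_mk, hιι]
    rw [← smul_neg, neg_sub]
  · simp only [ContinuousMap.coe_mk]
    refine ⟨?_, fun p hp => ?_⟩
    · rw [norm_smul, Real.norm_of_nonneg (by norm_num)]
      linarith [norm_sub_le (V x) (V (ι x)), (hV x).1, (hV (ι x)).1]
    · have h1 := (hV x).2 p hp
      have h2 := (hV (ι x)).2 (-p) (by simpa using hp)
      rw [hγι, ← neg_add, hneg, heven] at h2
      simp only [neg_apply] at h2
      simp only [map_smul, map_sub, smul_eq_mul]
      refine ⟨by linarith [h1.1, h2.1], fun hm => by linarith [h1.2 hm, h2.2 hm]⟩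

end Descent

section Minimax

variable {X : Type*} [NormedAddCommGroup X] [InnerProductSpace ℝ X]

theorem weakConv_synth_add [CompleteSpace X] {g : ℕ → X} (hg : Orthonormal ℝ g) {ρ : ℝ} (hρ : 0 ≤ ρ)
    (G : C(LinkDom ρ, X)) {y : ℕ → LinkDom ρ} {x : LinkDom ρ} (hy : Tendsto y atTop (𝓝 x)) :
    WeakConv (fun n => synth g (y n).1.1 + G (y n)) (synth g x.1.1 + G x) := by
  intro w
  have h1 : Continuous fun y : LinkDom ρ => ⟪synth g y.1.1, w⟫ :=
    (continuous_inner_synth hg hρ w).comp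
      (by fun_prop : Continuous fun y : LinkDom ρ => (⟨y.1.1, y.2.1⟩ : seqBall ρ))
  have h2 : Continuous fun y : LinkDom ρ => ⟪G y, w⟫ := G.continuous.inner continuous_const
  simp only [inner_add_left]
  exact ((h1.add h2).tendsto x).comp hy

/-- The admissible deformations: odd, trivial at time `0`, and not increasing `φ`. -/
def deformations (g : ℕ → X) (ρ : ℝ) (φ : X → ℝ) : Set C(LinkDom ρ, X) :=
  {G | ∀ x, G x.flip = -G x ∧ (x.1.2 = 0 → G x = 0) ∧
    φ (synth g x.1.1 + G x) ≤ φ (synth g x.1.1)}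

theorem isClosed_deformations (g : ℕ → X) (ρ : ℝ) {φ : X → ℝ} (hφ : Continuous φ) :
    IsClosed (deformations g ρ φ) := by
  have hev : ∀ x : LinkDom ρ, Continuous fun G : C(LinkDom ρ, X) => G x := fun x =>
    continuous_eval_const x
  simp only [deformations, ofPred_forall, ofPred_and]
  refine isClosed_iInter fun x => (isClosed_eq (hev _) (hev x).neg).inter (IsClosed.inter ?_ ?_)
  · exact isClosed_iInter fun _ => isClosed_eq (hev x) continuous_const
  · exact isClosed_le (hφ.comp (continuous_const.add (hev x))) continuous_const

theorem exists_critical_of_link [CompleteSpace X] {φ : X → ℝ} {φ' : X → X →L[ℝ] ℝ}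
    (hderiv : ∀ u, HasFDerivAt φ (φ' u) u) (hC1 : Continuous φ') (heven : ∀ u, φ (-u) = φ u)
    (hwsc : WeaklySeqContDeriv φ')
    (hPS : ∀ c : ℝ, 0 < c → ∀ u : ℕ → X,
      Tendsto (fun n => φ (u n)) atTop (𝓝 c) →
      Tendsto (fun n => ‖φ' (u n)‖) atTop (𝓝 0) →
      ∃ ψ : ℕ → ℕ, StrictMono ψ ∧ ∃ v : X, Tendsto (fun n => u (ψ n)) atTop (𝓝 v))
    {g : ℕ → X} (hg : Orthonormal ℝ g) {ρ r : ℝ} (hr : 0 < r) (hrρ : r < ρ)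
    (hcl : ∀ (G : C(LinkDom ρ, X)) (m : ℝ), IsClosed {x | m ≤ φ (synth g x.1.1 + G x)})
    {d : ℝ} (hd : ∀ a ∈ seqBall ρ, φ (synth g a) ≤ d)
    (hbd : ∀ a ∈ seqBall ρ, ‖synth g a‖ = ρ → φ (synth g a) ≤ 0)
    {M : ℝ} (hM : 0 < M) (hlink : ∀ z, ‖z‖ = r → (∀ j, 1 ≤ j → ⟪z, g j⟫ = 0) → M ≤ φ z) :
    ∃ v, φ' v = 0 ∧ M / 2 ≤ φ v := by
  by_contra! hcon
  have hρ : 0 ≤ ρ := (hr.trans hrρ).le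
  have hφ : Continuous φ := continuous_iff_continuousAt.2 fun u => (hderiv u).continuousAt
  obtain ⟨δ, hδ, hnorm⟩ := exists_lt_norm_deriv (d := d) hφ hC1 hPS (half_pos hM)
    (fun v hv h0 => absurd hv (not_le.2 (hcon v h0)))
  let E := deformations g ρ φ
  have : CompleteSpace E := (isClosed_deformations g ρ hφ).completeSpace_coe
  have h0E : (0 : C(LinkDom ρ, X)) ∈ E := fun x => by simp
  have : Nonempty E := ⟨⟨0, h0E⟩⟩
  let T := {x : LinkDom ρ // x.1.2 = 1}
  let Φ : E → ℝ := fun G => ⨆ x : T, φ (synth g x.1.1.1 + G.1 x.1)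
  have hbdd : ∀ G : E, BddAbove (range fun x : T => φ (synth g x.1.1.1 + G.1 x.1)) := by
    rintro G
    refine ⟨d, ?_⟩
    rintro _ ⟨x, rfl⟩
    exact (G.2 x.1).2.2.trans (hd _ x.1.2.1)
  have hle : ∀ (G : E) (x : T), φ (synth g x.1.1.1 + G.1 x.1) ≤ Φ G := fun G x =>
    le_ciSup (hbdd G) x
  have hΦM : ∀ G : E, M ≤ Φ G := by
    intro G
    obtain ⟨x, hx1, hx2, hx3⟩ := exists_link hg hr hrρ G.1 (fun x => (G.2 x).1)
      (fun x => (G.2 x).2.1) (fun x h1 h2 h3 => by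
        have h4 := hlink _ h2 h3
        have h5 := (G.2 x).2.2
        have h6 := hbd _ x.2.1 h1
        linarith)
    exact (hlink _ hx2 hx3).trans (hle G ⟨x, hx1⟩)
  have hT : Nonempty T := ⟨⟨⟨(0, 1), by simp [seqBall, sq_nonneg]⟩, rfl⟩⟩
  have hlsc : LowerSemicontinuous Φ := by
    refine lowerSemicontinuous_ciSup hbdd fun x => Continuous.lowerSemicontinuous ?_
    exact hφ.comp (continuous_const.add ((continuous_eval_const x.1).comp continuous_subtype_val))
  obtain ⟨G, hG⟩ := exists_ekeland hlsc ⟨M, by rintro _ ⟨G, rfl⟩; exact hΦM G⟩ (half_pos hδ)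
  set γ : LinkDom ρ → X := fun x => synth g x.1.1 + G.1 x with hγ
  have hγflip : ∀ x, γ x.flip = -γ x := by
    intro x
    simp only [hγ, (G.2 x).1]
    simp only [LinkDom.flip, synth_neg]
    abel
  obtain ⟨V, h₁, hh₁, hVodd, hV⟩ := exists_odd_descent_field hwsc heven
    (deriv_neg_of_even hderiv heven) (γ := γ) (fun y x hy => weakConv_synth_add hg hρ G.1 hy)
    LinkDom.continuous_flip (fun x => by simp [LinkDom.flip]) hγflip hδ.le (hcl G.1 (M / 2))
    (fun x hx => hnorm _ hx ((G.2 x).2.2.trans (hd _ x.2.1)))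
  set h : ℝ := min h₁ (M / 2 / δ) with hh
  have hhpos : 0 < h := lt_min hh₁ (by positivity)
  have hhδ : h * δ ≤ M / 2 := (le_div_iff₀ hδ).1 (min_le_right _ _)
  have hdec : ∀ x : LinkDom ρ, ∀ κ : ℝ, (κ = 0 ∨ κ = δ ∧ M / 2 ≤ φ (γ x)) → ∀ s ∈ Icc 0 h,
      φ (γ x - s • V x) ≤ φ (γ x) - κ * s := by
    intro x κ hκ s hs
    refine sub_smul_le_of_le_deriv hderiv (h := h) (fun s hs => ?_) hs
    have hp : ‖-(s • V x)‖ ≤ h₁ := by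
      rw [norm_neg, norm_smul, Real.norm_of_nonneg hs.1]
      have := hs.2.trans (min_le_left _ _)
      nlinarith [(hV x).1, norm_nonneg (V x), hs.1]
    have h1 := (hV x).2 _ hp
    rw [← sub_eq_add_neg] at h1
    rcases hκ with rfl | ⟨rfl, h2⟩
    · exact h1.1
    · exact h1.2 h2
  have hts : ∀ x : LinkDom ρ, x.1.2 * h ∈ Icc 0 h := fun x =>
    ⟨mul_nonneg x.2.2.1 hhpos.le, mul_le_of_le_one_left hhpos.le x.2.2.2⟩
  let W : C(LinkDom ρ, X) := ⟨fun x => (x.1.2 * h) • V x, by fun_prop⟩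
  have hW : ∀ x, W x = (x.1.2 * h) • V x := fun x => rfl
  have hγW : ∀ x, synth g x.1.1 + (G.1 - W) x = γ x - (x.1.2 * h) • V x := by
    intro x
    simp only [ContinuousMap.sub_apply, hW, hγ]
    abel
  have hGW : G.1 - W ∈ E := by
    intro x
    refine ⟨?_, fun h0 => ?_, ?_⟩
    · simp only [ContinuousMap.sub_apply, hW, (G.2 x).1, hVodd]
      simp only [LinkDom.flip, smul_neg]
      abel
    · simp [hW, (G.2 x).2.1 h0, h0]
    · rw [hγW]
      have := hdec x 0 (Or.inl rfl) _ (hts x)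
      rw [zero_mul, sub_zero] at this
      exact this.trans (G.2 x).2.2
  have hΦle : Φ ⟨G.1 - W, hGW⟩ ≤ Φ G - δ * h := by
    refine ciSup_le fun x => ?_
    have hx1 : x.1.1.2 * h = h := by rw [x.2, one_mul]
    change φ (synth g x.1.1.1 + (G.1 - W) x.1) ≤ _
    rw [hγW, hx1]
    have hGx := hle G x
    have hMG := hΦM G
    by_cases hm : M / 2 ≤ φ (γ x.1)
    · have := hdec x.1 δ (Or.inr ⟨rfl, hm⟩) h ⟨hhpos.le, le_rfl⟩
      exact this.trans (sub_le_sub_right hGx _)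
    · have := hdec x.1 0 (Or.inl rfl) h ⟨hhpos.le, le_rfl⟩
      rw [zero_mul] at this
      linarith
  have hdist : dist G ⟨G.1 - W, hGW⟩ ≤ h := by
    rw [Subtype.dist_eq, ContinuousMap.dist_le hhpos.le]
    intro x
    rw [dist_eq_norm, ContinuousMap.sub_apply, sub_sub_cancel, hW, norm_smul,
      Real.norm_of_nonneg (hts x).1]
    nlinarith [(hV x).1, norm_nonneg (V x), (hts x).1, (hts x).2]
  have hδh : 0 < δ * h := mul_pos hδ hhpos
  have heq := hG ⟨G.1 - W, hGW⟩ (by nlinarith)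
  rw [heq] at hΦle
  linarith

end Minimax

namespace FountainSetup

variable {X : Type*} [NormedAddCommGroup X] [InnerProductSpace ℝ X] [CompleteSpace X]
variable (S : FountainSetup X)

/-- The index map of `linkBasis`. -/
def linkIndex (k : ℕ) : ℕ → ℕ ⊕ ℕ
  | 0 => Sum.inl k
  | j + 1 => if j < k then Sum.inl j else Sum.inr (j - k)

/-- The orthonormal basis `f k, f 0, …, f (k - 1), e 0, e 1, …` of `Y_k`. -/
def linkBasis (k j : ℕ) : X := Sum.elim S.f S.e (linkIndex k j)

theorem linkIndex_injective (k : ℕ) : Function.Injective (linkIndex k) := by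
  intro i j h
  rcases i with _ | i <;> rcases j with _ | j <;> simp only [linkIndex] at h
  · rfl
  · split_ifs at h with hj
    simp only [Sum.inl.injEq] at h
    omega
  · split_ifs at h with hi
    simp only [Sum.inl.injEq] at h
    omega
  · split_ifs at h <;> simp only [Sum.inl.injEq, Sum.inr.injEq] at h <;> omega

theorem linkBasis_succ_of_lt {k j : ℕ} (h : j < k) : S.linkBasis k (j + 1) = S.f j := by
  simp [linkBasis, linkIndex, h]

theorem linkBasis_add (k j : ℕ) : S.linkBasis k (k + j + 1) = S.e j := by
  simp [linkBasis, linkIndex]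

theorem inner_e_f (i j : ℕ) : ⟪S.e i, S.f j⟫ = 0 := S.f_mem j _ (S.e_mem i)

theorem orthonormal_linkBasis (k : ℕ) : Orthonormal ℝ (S.linkBasis k) := by
  have h : Orthonormal ℝ (Sum.elim S.f S.e) := by
    refine ⟨?_, ?_⟩
    · rintro (i | i)
      · exact S.orth_f.1 i
      · exact S.orth_e.1 i
    · rintro (i | i) (j | j) hij
      · exact S.orth_f.2 fun h => hij (by rw [h])
      · exact (real_inner_comm _ _).trans (S.inner_e_f j i)
      · exact S.inner_e_f i j
      · exact S.orth_e.2 fun h => hij (by rw [h])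
  exact h.comp _ (linkIndex_injective k)

theorem linkBasis_mem (k j : ℕ) : S.linkBasis k j ∈ S.Yk k := by
  have hf : ∀ i ≤ k, S.f i ∈ S.Yk k := fun i hi =>
    Submodule.mem_sup_right (Submodule.subset_span ⟨i, hi, rfl⟩)
  rcases j with _ | j
  · exact hf k le_rfl
  · rcases lt_or_ge j k with h | h
    · rw [S.linkBasis_succ_of_lt h]
      exact hf j h.le
    · obtain ⟨i, rfl⟩ := Nat.exists_eq_add_of_le h
      rw [linkBasis_add]
      exact Submodule.mem_sup_left (S.e_mem i)

theorem isClosed_Yk (k : ℕ) : IsClosed (S.Yk k : Set X) := by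
  have : FiniteDimensional ℝ (Submodule.span ℝ (S.f '' {j | j ≤ k})) :=
    FiniteDimensional.span_of_finite ℝ ((Set.finite_Iic k).image _)
  exact Submodule.isClosed_sup_finiteDimensional _ _ S.closedY

theorem synth_linkBasis_mem (k : ℕ) {ρ : ℝ} {a : ℕ → ℝ} (ha : a ∈ seqBall ρ) :
    synth (S.linkBasis k) a ∈ S.Yk k := by
  refine (S.isClosed_Yk k).mem_of_tendsto
    (hasSum_synth (S.orthonormal_linkBasis k) ha).tendsto_sum_nat ?_
  exact Eventually.of_forall fun n => (S.Yk k).sum_mem fun i _ =>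
    (S.Yk k).smul_mem _ (S.linkBasis_mem k i)

theorem mem_Zk_of_inner_eq_zero {k : ℕ} {z : X}
    (hz : ∀ j, 1 ≤ j → ⟪z, S.linkBasis k j⟫ = 0) : z ∈ S.Zk k := by
  have hze : ∀ i, ⟪z, S.e i⟫ = 0 := fun i => by
    rw [← S.linkBasis_add k i]
    exact hz _ (by omega)
  have hzf : ∀ i < k, ⟪z, S.f i⟫ = 0 := fun i hi => by
    rw [← S.linkBasis_succ_of_lt hi]
    exact hz _ (by omega)
  have hort : ∀ v, (∀ i, k ≤ i → ⟪S.f i, v⟫ = 0) → ∀ y ∈ S.Zk k, ⟪y, v⟫ = 0 := by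
    intro v hv y hy
    have hle : S.Zk k ≤ (ℝ ∙ v)ᗮ := by
      refine Submodule.topologicalClosure_minimal _ ?_ (Submodule.isClosed_orthogonal _)
      rw [Submodule.span_le]
      rintro _ ⟨i, hi, rfl⟩
      exact Submodule.mem_orthogonal_singleton_iff_inner_left.2 (hv i hi)
    exact Submodule.mem_orthogonal_singleton_iff_inner_left.1 (hle hy)
  have hcl : IsClosed (S.Zk k : Set X) := Submodule.isClosed_topologicalClosure _
  have : CompleteSpace (S.Zk k) := hcl.completeSpace_coe
  obtain ⟨y, hy, w, hw, rfl⟩ := (S.Zk k).exists_add_mem_mem_orthogonal z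
  have hwe : ∀ i, ⟪S.e i, w⟫ = 0 := by
    intro i
    have h1 := hze i
    rw [inner_add_left, hort (S.e i) (fun j _ => (real_inner_comm _ _).trans (S.inner_e_f i j)) y hy,
      zero_add] at h1
    rwa [real_inner_comm]
  have hwf : ∀ i, ⟪S.f i, w⟫ = 0 := by
    intro i
    rcases lt_or_ge i k with h | h
    · have h1 := hzf i h
      rw [inner_add_left, hort (S.f i) (fun j hj => S.orth_f.2 (by omega)) y hy, zero_add] at h1
      rwa [real_inner_comm]
    · exact hw _ (Submodule.le_topologicalClosure _ (Submodule.subset_span ⟨i, h, rfl⟩))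
  have hspan : ∀ b : ℕ → X, (∀ i, ⟪b i, w⟫ = 0) →
      (Submodule.span ℝ (Set.range b)).topologicalClosure ≤ (ℝ ∙ w)ᗮ := by
    intro b hb
    refine Submodule.topologicalClosure_minimal _ ?_ (Submodule.isClosed_orthogonal _)
    rw [Submodule.span_le]
    rintro _ ⟨i, rfl⟩
    exact Submodule.mem_orthogonal_singleton_iff_inner_left.2 (hb i)
  have hY := hspan S.e hwe
  have hZ := hspan S.f hwf
  rw [S.span_e] at hY
  rw [S.span_f] at hZ
  have hmem := Submodule.add_mem _ (hY (S.P_mem w)) (hZ (S.Q_mem w))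
  rw [S.P_add_Q] at hmem
  have hw0 : w = 0 := inner_self_eq_zero.1 (Submodule.mem_orthogonal_singleton_iff_inner_left.1 hmem)
  rw [hw0, add_zero]
  exact hy

theorem Q_eq_zero_of_mem {y : X} (hy : y ∈ S.Y) : S.Q y = 0 := by
  have h1 : S.Q y ∈ S.Y := by
    have : S.Q y = y - S.P y := by rw [eq_sub_iff_add_eq', S.P_add_Q]
    rw [this]
    exact S.Y.sub_mem hy (S.P_mem y)
  exact inner_self_eq_zero.1 (S.Q_mem y _ h1)

theorem inner_P_e (u : X) (j : ℕ) : ⟪S.P u, S.e j⟫ = ⟪u, S.e j⟫ := by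
  conv_rhs => rw [← S.P_add_Q u, inner_add_left]
  rw [real_inner_comm (S.e j) (S.Q u), S.Q_mem u _ (S.e_mem j), add_zero]

theorem tauTendsto_of_weakConv {u : ℕ → X} {v : X} {C : ℝ} (hb : ∀ n, ‖u n‖ ≤ C)
    (hw : WeakConv u v) (hQ : Tendsto (fun n => S.Q (u n)) atTop (𝓝 (S.Q v))) :
    S.TauTendsto u v := by
  have h1 : Tendsto (fun n => ∑' j : ℕ, (1 / 2 : ℝ) ^ (j + 1) * |⟪S.P (u n - v), S.e j⟫|) atTop
      (𝓝 (∑' _ : ℕ, (0 : ℝ))) := by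
    refine tendsto_tsum_of_dominated_convergence
      (bound := fun j => (1 / 2 : ℝ) ^ (j + 1) * (C + ‖v‖)) ?_ ?_ ?_
    · exact ((summable_nat_add_iff 1).2 summable_geometric_two).mul_right _
    · intro j
      have := (((hw (S.e j)).sub_const ⟪v, S.e j⟫).abs).const_mul ((1 / 2 : ℝ) ^ (j + 1))
      simpa only [inner_P_e, inner_sub_left, sub_self, abs_zero, mul_zero] using this
    · refine Eventually.of_forall fun n j => ?_
      rw [inner_P_e, Real.norm_of_nonneg (by positivity)]
      gcongr
      refine (abs_real_inner_le_norm _ _).trans ?_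
      rw [S.orth_e.1 j, mul_one]
      exact (norm_sub_le _ _).trans (by gcongr; exact hb n)
  have h2 : Tendsto (fun n => ‖S.Q (u n - v)‖) atTop (𝓝 0) := by
    simp only [map_sub]
    simpa using (hQ.sub_const (S.Q v)).norm
  rw [tsum_zero] at h1
  simpa [TauTendsto, tauNorm] using h1.max h2

theorem Q_synth_linkBasis (k : ℕ) {ρ : ℝ} {a : ℕ → ℝ} (ha : a ∈ seqBall ρ) :
    S.Q (synth (S.linkBasis k) a) =
      ∑ i ∈ Finset.range (k + 1), a i • S.Q (S.linkBasis k i) := by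
  have h1 := (hasSum_synth (S.orthonormal_linkBasis k) ha).mapL S.Q
  refine h1.unique ?_
  simp only [map_smul]
  refine hasSum_sum_of_ne_finset_zero fun i hi => ?_
  obtain ⟨j, rfl⟩ := Nat.exists_eq_add_of_le (by simpa using hi : k + 1 ≤ i)
  rw [show k + 1 + j = k + j + 1 by ring, linkBasis_add, S.Q_eq_zero_of_mem (S.e_mem j), smul_zero]

theorem isClosed_le_comp_synth {φ : X → ℝ}
    (husc : ∀ c : ℝ, ∀ (u : ℕ → X) (v : X),
      (∀ n, c ≤ φ (u n)) → S.TauTendsto u v → c ≤ φ v)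
    (k : ℕ) {ρ : ℝ} (hρ : 0 ≤ ρ) (G : C(LinkDom ρ, X)) (m : ℝ) :
    IsClosed {x | m ≤ φ (synth (S.linkBasis k) x.1.1 + G x)} := by
  have hg := S.orthonormal_linkBasis k
  refine IsSeqClosed.isClosed fun y x hy hlim => ?_
  refine husc m (fun n => synth (S.linkBasis k) (y n).1.1 + G (y n)) _ hy ?_
  refine S.tauTendsto_of_weakConv (C := ρ + ‖G‖) (fun n => ?_) (weakConv_synth_add hg hρ G hlim) ?_
  · exact (norm_add_le _ _).trans (add_le_add (norm_synth_le hg hρ (y n).2.1) (G.norm_coe_le_norm _))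
  · have hc : Continuous fun x : LinkDom ρ => S.Q (synth (S.linkBasis k) x.1.1 + G x) := by
      have : (fun x : LinkDom ρ => S.Q (synth (S.linkBasis k) x.1.1 + G x)) = fun x =>
          ∑ i ∈ Finset.range (k + 1), x.1.1 i • S.Q (S.linkBasis k i) + S.Q (G x) := by
        funext x
        rw [map_add, S.Q_synth_linkBasis k x.2.1]
      rw [this]
      fun_prop
    exact (hc.tendsto x).comp hlim

end FountainSetup

/-- **Fountain theorem of Batkam–Colin.**  If `φ ∈ C¹(X, ℝ)` is even, `∇φ` is weakly
sequentially continuous, `φ` is τ-upper semi-continuous, `φ` satisfies the `(PS)_c`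
condition for every `c > 0`, and for every `k` there are `ρ_k > r_k > 0` satisfying
`(A₁)`, `(A₂)`, `(A₃)`, then `φ` has an unbounded sequence of critical values. -/
theorem fountain_theorem_batkam_colin
    {X : Type*} [NormedAddCommGroup X] [InnerProductSpace ℝ X] [CompleteSpace X]
    (S : FountainSetup X) (φ : X → ℝ) (φ' : X → X →L[ℝ] ℝ)
    -- φ ∈ C¹(X, ℝ)
    (hderiv : ∀ u, HasFDerivAt φ (φ' u) u) (hC1 : Continuous φ')
    -- φ is even
    (heven : ∀ u, φ (-u) = φ u)
    -- ∇φ is weakly sequentially continuous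
    (hwsc : WeaklySeqContDeriv φ')
    -- φ is τ-upper semi-continuous: every set {φ ≥ c} is τ-(sequentially) closed
    (husc : ∀ c : ℝ, ∀ (u : ℕ → X) (v : X),
      (∀ n, c ≤ φ (u n)) → S.TauTendsto u v → c ≤ φ v)
    -- (PS)_c condition for every c > 0
    (hPS : ∀ c : ℝ, 0 < c → ∀ u : ℕ → X,
      Tendsto (fun n => φ (u n)) atTop (𝓝 c) →
      Tendsto (fun n => ‖φ' (u n)‖) atTop (𝓝 0) →
      ∃ ψ : ℕ → ℕ, StrictMono ψ ∧ ∃ v : X, Tendsto (fun n => u (ψ n)) atTop (𝓝 v))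
    (ρ r : ℕ → ℝ) (hr : ∀ k, 0 < r k) (hρr : ∀ k, r k < ρ k)
    -- (A₁) : d_k = sup {φ(u) : u ∈ Y_k, ‖u‖ ≤ ρ_k} < ∞
    (hA1 : ∀ k, ∃ d : ℝ, ∀ u ∈ S.Yk k, ‖u‖ ≤ ρ k → φ u ≤ d)
    -- (A₂) : a_k = sup {φ(u) : u ∈ Y_k, ‖u‖ = ρ_k} ≤ 0
    (hA2 : ∀ k, ∀ u ∈ S.Yk k, ‖u‖ = ρ k → φ u ≤ 0)
    -- (A₃) : b_k = inf {φ(u) : u ∈ Z_k, ‖u‖ = r_k} → ∞ as k → ∞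
    (hA3 : ∀ M : ℝ, ∃ K : ℕ, ∀ k ≥ K, ∀ u ∈ S.Zk k, ‖u‖ = r k → M ≤ φ u) :
    -- φ has an unbounded sequence of critical values
    ∃ u : ℕ → X, (∀ n, φ' (u n) = 0) ∧ Tendsto (fun n => φ (u n)) atTop atTop := by
  have hcrit : ∀ n : ℕ, ∃ v, φ' v = 0 ∧ (2 * ((n : ℝ) + 1)) / 2 ≤ φ v := by
    intro n
    obtain ⟨k, hk⟩ := hA3 (2 * ((n : ℝ) + 1))
    obtain ⟨d, hd⟩ := hA1 k
    have hg := S.orthonormal_linkBasis k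
    have hρ : 0 ≤ ρ k := ((hr k).trans (hρr k)).le
    exact exists_critical_of_link hderiv hC1 heven hwsc hPS hg (hr k) (hρr k)
      (S.isClosed_le_comp_synth husc k hρ)
      (fun a ha => hd _ (S.synth_linkBasis_mem k ha) (norm_synth_le hg hρ ha))
      (fun a ha => hA2 k _ (S.synth_linkBasis_mem k ha)) (by positivity)
      (fun z hz hzj => hk k le_rfl z (S.mem_Zk_of_inner_eq_zero hzj) hz)
  choose u hu1 hu2 using hcrit
  refine ⟨u, hu1, tendsto_atTop_mono (fun n => ?_) tendsto_natCast_atTop_atTop⟩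
  linarith [hu2 n]

end
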